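/- Let w = g₁⋯g_n be a cyclically reduced word over the alphabet 𝒜 with n ≥ 2 such that no two cyclically consecutive letters of w are equal (g_{i+1} ≠ g_i for all i, indices mod n). Then I(w) ≥ n²/6. -/

import Mathlib

open scoped Classical

abbrev SL2Z := Matrix.SpecialLinearGroup (Fin 2) ℤ

def Amat : SL2Z := ⟨!![1, 2; 0, 1], by norm_num [Matrix.det_fin_two_of]⟩
def Bmat : SL2Z := ⟨!![1, 0; -2, 1], by norm_num [Matrix.det_fin_two_of]⟩
def Cmat : SL2Z := (Amat * Bmat)⁻¹

def Gamma : Subgroup SL2Z := Subgroup.closure {Amat, Bmat}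

/-- The real entry `i j` of a matrix in `SL₂(ℤ)`. -/
def entry (g : SL2Z) (i j : Fin 2) : ℝ := ((g : Matrix (Fin 2) (Fin 2) ℤ) i j : ℤ)

/-- The Möbius action of `SL₂(ℤ)` on the circle `ℝ ∪ {∞}`. -/
noncomputable def mobius (g : SL2Z) (p : OnePoint ℝ) : OnePoint ℝ :=
  Option.rec (motive := fun _ => OnePoint ℝ)
    (if entry g 1 0 = 0 then OnePoint.infty
     else OnePoint.some (entry g 0 0 / entry g 1 0))
    (fun x => if entry g 1 0 * x + entry g 1 1 = 0 then OnePoint.infty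
      else OnePoint.some ((entry g 0 0 * x + entry g 0 1) / (entry g 1 0 * x + entry g 1 1)))
    p

/-- The fixed-point set of `g` acting on the circle `ℝ ∪ {∞}`. -/
noncomputable def fixedSet (g : SL2Z) : Set (OnePoint ℝ) := {p | mobius g p = p}

/-- `g` is hyperbolic if `|trace g| > 2`. -/
def Hyperbolic (g : SL2Z) : Prop := 2 < |Matrix.trace (g : Matrix (Fin 2) (Fin 2) ℤ)|

/-- Two two-element subsets of the circle are linked if the two points of `Q` lie in
different connected components of the complement of `P`. -/
def Linked (P Q : Set (OnePoint ℝ)) : Prop :=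
  ∃ q₁ q₂ : OnePoint ℝ, q₁ ≠ q₂ ∧ Q = {q₁, q₂} ∧
    connectedComponentIn Pᶜ q₁ ≠ connectedComponentIn Pᶜ q₂

/-- `h` contributes to the count `s(v)`: `v` and `h * v * h⁻¹` are hyperbolic with
linked fixed-point sets. -/
def GoodConj (v h : Gamma) : Prop :=
  Hyperbolic (v : SL2Z) ∧ Hyperbolic ((h * v * h⁻¹ : Gamma) : SL2Z) ∧
    Linked (fixedSet (v : SL2Z)) (fixedSet ((h * v * h⁻¹ : Gamma) : SL2Z))

/-- Twice `s(v)`: the number of double cosets `⟨v⟩ h ⟨v⟩` in `Γ` such that `v` and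
`h * v * h⁻¹` are hyperbolic with linked fixed-point sets. -/
noncomputable def sTwo (v : Gamma) : ℕ :=
  Nat.card (Quot (fun h h' : {h : Gamma // GoodConj v h} =>
    ∃ m k : ℤ, (h' : Gamma) = v ^ m * (h : Gamma) * v ^ k))

/-- `v` is not a proper power in `Γ`. -/
def NotProperPower (v : Gamma) : Prop := ¬ ∃ u : Gamma, ∃ k : ℕ, 2 ≤ k ∧ v = u ^ k

/-- The self-intersection number `I(g) = n² s(v) + n - 1`, where `g = vⁿ` with `v` not a
proper power and `n ≥ 1`, and `s(v)` is half the number of good double cosets. -/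
noncomputable def Iγ (g : Gamma) : ℤ :=
  if h : ∃ p : Gamma × ℕ, 1 ≤ p.2 ∧ NotProperPower p.1 ∧ g = p.1 ^ p.2 then
    (h.choose.2 : ℤ) ^ 2 * ((sTwo h.choose.1 / 2 : ℕ) : ℤ) + (h.choose.2 : ℤ) - 1
  else 0
/-- The six-letter alphabet `𝒜 = {a, b, c, ā, b̄, c̄}`. -/
inductive Gen | a | b | c | a' | b' | c'
deriving DecidableEq

/-- The matrix assigned to each letter of `𝒜`. -/
def genM : Gen → SL2Z
  | .a => Amat
  | .b => Bmat
  | .c => Cmat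
  | .a' => Amat⁻¹
  | .b' => Bmat⁻¹
  | .c' => Cmat⁻¹

/-- The formal inverse of a letter of `𝒜`. -/
def genInv : Gen → Gen
  | .a => .a'
  | .a' => .a
  | .b => .b'
  | .b' => .b
  | .c => .c'
  | .c' => .c

/-- The forbidden two-letter subwords: `aā, āa, bb̄, b̄b, cc̄, c̄c, ab, bc, ca, b̄ā, c̄b̄, āc̄`. -/
def BadPair (p q : Gen) : Prop :=
  (p, q) ∈ ([(.a, .a'), (.a', .a), (.b, .b'), (.b', .b), (.c, .c'), (.c', .c),
    (.a, .b), (.b, .c), (.c, .a), (.b', .a'), (.c', .b'), (.a', .c')] : List (Gen × Gen))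

/-- The letter of `w` at cyclic position `i`. -/
def cget6 (w : List Gen) (i : ℕ) : Gen := w.getD (i % w.length) Gen.a

/-- `w` is cyclically reduced: nonempty, and no cyclically consecutive pair of letters is
a forbidden subword. -/
def CyclRed6 (w : List Gen) : Prop :=
  w ≠ [] ∧ ∀ i : ℕ, i < w.length → ¬ BadPair (cget6 w i) (cget6 w (i + 1))

/-- `φ(w)`: the product of the matrices assigned to the letters of `w`. -/
def phi6 (w : List Gen) : SL2Z := (w.map genM).prod

lemma genM_mem (g : Gen) : genM g ∈ Gamma := by
  have hA : Amat ∈ Gamma := Subgroup.subset_closure (by simp)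
  have hB : Bmat ∈ Gamma := Subgroup.subset_closure (by simp)
  have hC : Cmat ∈ Gamma := inv_mem (mul_mem hA hB)
  cases g <;> simp only [genM] <;>
    first
      | exact hA | exact hB | exact hC
      | exact inv_mem hA | exact inv_mem hB | exact inv_mem hC

lemma phi6_mem (w : List Gen) : phi6 w ∈ Gamma := by
  refine Subgroup.list_prod_mem _ ?_
  intro m hm
  rcases List.mem_map.1 hm with ⟨g, -, rfl⟩
  exact genM_mem g

/-- The self-intersection number of the six-letter word `w`. -/
noncomputable def I6 (w : List Gen) : ℤ := Iγ ⟨phi6 w, phi6_mem w⟩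

/-- `w` is primitive: as a cyclic word it is not a `k`-fold concatenation of a shorter
word for any `k ≥ 2`. -/
def Primitive6 (w : List Gen) : Prop :=
  ¬ ∃ u : List Gen, ∃ k : ℕ, 2 ≤ k ∧ u.length < w.length ∧
      ∃ j : ℕ, w.rotate j = (List.replicate k u).flatten


/-! ### Matrix bookkeeping in `SL₂(ℤ)` -/

/-- The trace of an element of `SL₂(ℤ)`. -/
def tr (g : SL2Z) : ℤ := g 0 0 + g 1 1

/-- The discriminant of the characteristic polynomial. -/
def disc (g : SL2Z) : ℤ := tr g ^ 2 - 4

/-- The axes of `g` and `h` cross, in terms of traces. -/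
def Crosses (g h : SL2Z) : Prop := (2 * tr (g * h) - tr g * tr h) ^ 2 < disc g * disc h

lemma det_eq (g : SL2Z) : g 0 0 * g 1 1 - g 0 1 * g 1 0 = 1 := by
  have := g.det_coe
  rwa [Matrix.det_fin_two] at this

lemma mul_apply_two (g h : SL2Z) (i j : Fin 2) :
    (g * h) i j = g i 0 * h 0 j + g i 1 * h 1 j := by
  rw [Matrix.SpecialLinearGroup.coe_mul, Matrix.mul_apply, Fin.sum_univ_two]

lemma inv00 (g : SL2Z) : g⁻¹ 0 0 = g 1 1 := by
  simp [Matrix.SpecialLinearGroup.coe_inv, Matrix.adjugate_fin_two]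

lemma inv01 (g : SL2Z) : g⁻¹ 0 1 = - g 0 1 := by
  simp [Matrix.SpecialLinearGroup.coe_inv, Matrix.adjugate_fin_two]

lemma inv10 (g : SL2Z) : g⁻¹ 1 0 = - g 1 0 := by
  simp [Matrix.SpecialLinearGroup.coe_inv, Matrix.adjugate_fin_two]

lemma inv11 (g : SL2Z) : g⁻¹ 1 1 = g 0 0 := by
  simp [Matrix.SpecialLinearGroup.coe_inv, Matrix.adjugate_fin_two]

lemma one_entries : (1 : SL2Z) 0 0 = 1 ∧ (1 : SL2Z) 0 1 = 0 ∧ (1 : SL2Z) 1 0 = 0 ∧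
    (1 : SL2Z) 1 1 = 1 := by
  simp

lemma ext_two {g h : SL2Z} (h00 : g 0 0 = h 0 0) (h01 : g 0 1 = h 0 1) (h10 : g 1 0 = h 1 0)
    (h11 : g 1 1 = h 1 1) : g = h := by
  ext i j
  fin_cases i <;> fin_cases j <;> assumption

lemma tr_mul_comm (g h : SL2Z) : tr (g * h) = tr (h * g) := by
  simp only [tr, mul_apply_two]; ring

lemma tr_conj (k g : SL2Z) : tr (k * g * k⁻¹) = tr g := by
  rw [tr_mul_comm, inv_mul_cancel_left]

lemma disc_conj (k g : SL2Z) : disc (k * g * k⁻¹) = disc g := by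
  rw [disc, tr_conj, disc]

lemma disc_eq (g : SL2Z) : disc g = (g 0 0 - g 1 1) ^ 2 + 4 * (g 0 1 * g 1 0) := by
  have := det_eq g
  simp only [disc, tr]; linear_combination 4 * this

lemma crosses_conj (k g h : SL2Z) :
    Crosses (k * g * k⁻¹) (k * h * k⁻¹) ↔ Crosses g h := by
  have : k * g * k⁻¹ * (k * h * k⁻¹) = k * (g * h) * k⁻¹ := by group
  rw [Crosses, this, tr_conj, tr_conj, tr_conj, disc_conj, disc_conj, Crosses]

lemma not_crosses_self (g : SL2Z) : ¬ Crosses g g := by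
  have h : 2 * tr (g * g) - tr g * tr g = disc g := by
    rw [disc_eq]; simp only [tr, mul_apply_two]; ring
  rw [Crosses, h]; nlinarith

lemma crosses_inv_conj {v h : SL2Z} (hc : Crosses v (h * v * h⁻¹)) :
    Crosses v (h⁻¹ * v * h) := by
  have h1 : tr (v * (h⁻¹ * v * h)) = tr (v * (h * v * h⁻¹)) := by
    rw [← tr_conj h (v * (h⁻¹ * v * h)), tr_mul_comm v]
    congr 1; group
  have h2 : tr (h⁻¹ * v * h) = tr v := by simpa using tr_conj h⁻¹ v
  have h3 : disc (h⁻¹ * v * h) = disc v := by rw [disc, h2, disc]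
  rw [Crosses, tr_conj, disc_conj] at hc
  rwa [Crosses, h1, h2, h3]

lemma hyperbolic_iff (g : SL2Z) : Hyperbolic g ↔ 0 < disc g := by
  have : Matrix.trace (g : Matrix (Fin 2) (Fin 2) ℤ) = tr g := by
    rw [Matrix.trace_fin_two, tr]
  rw [Hyperbolic, this, disc, sub_pos, show (4 : ℤ) = 2 ^ 2 by norm_num, sq_lt_sq, abs_two]

lemma lower_left_ne_zero {g : SL2Z} (hg : 0 < disc g) : g 1 0 ≠ 0 := by
  intro h
  have hd := det_eq g
  rw [h, mul_zero, sub_zero] at hd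
  rw [disc, tr] at hg
  rcases Int.mul_eq_one_iff_eq_one_or_neg_one.1 hd with ⟨h1, h2⟩ | ⟨h1, h2⟩ <;>
    · rw [h1, h2] at hg; norm_num at hg

/-! ### Powers -/

/-- Chebyshev coefficients: `gⁿ⁺¹ = cheb (tr g) (n + 1) • g - cheb (tr g) n`. -/
def cheb (t : ℤ) : ℕ → ℤ
  | 0 => 0
  | 1 => 1
  | n + 2 => t * cheb t (n + 1) - cheb t n

lemma pow_entries (g : SL2Z) (n : ℕ) : ∃ x : ℤ,
    (g ^ n) 0 0 = x + cheb (tr g) n * g 0 0 ∧ (g ^ n) 0 1 = cheb (tr g) n * g 0 1 ∧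
    (g ^ n) 1 0 = cheb (tr g) n * g 1 0 ∧ (g ^ n) 1 1 = x + cheb (tr g) n * g 1 1 := by
  obtain ⟨i1, i2, i3, i4⟩ := one_entries
  have hd := det_eq g
  cases n with
  | zero => exact ⟨1, by simp [cheb]⟩
  | succ n =>
    refine ⟨- cheb (tr g) n, ?_⟩
    induction n with
    | zero => simp [cheb]
    | succ n ih =>
      obtain ⟨h1, h2, h3, h4⟩ := ih
      simp only [pow_succ g (n + 1), mul_apply_two, h1, h2, h3, h4, cheb, tr]
      refine ⟨?_, ?_, ?_, ?_⟩
      · linear_combination (- cheb (g 0 0 + g 1 1) (n + 1)) * hd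
      · ring
      · ring
      · linear_combination (- cheb (g 0 0 + g 1 1) (n + 1)) * hd

lemma disc_pow (g : SL2Z) (n : ℕ) : disc (g ^ n) = cheb (tr g) n ^ 2 * disc g := by
  obtain ⟨x, h1, h2, h3, h4⟩ := pow_entries g n
  rw [disc_eq, disc_eq, h1, h2, h3, h4]; ring

lemma crosses_pow_iff (v h : SL2Z) (n : ℕ) (hn : cheb (tr v) n ≠ 0) :
    Crosses (v ^ n) (h * v ^ n * h⁻¹) ↔ Crosses v (h * v * h⁻¹) := by
  have hd := det_eq h
  have key : 2 * tr (v ^ n * (h * v ^ n * h⁻¹)) - tr (v ^ n) * tr (v ^ n) =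
      cheb (tr v) n ^ 2 * (2 * tr (v * (h * v * h⁻¹)) - tr v * tr v) := by
    obtain ⟨x, h1, h2, h3, h4⟩ := pow_entries v n
    generalize cheb (tr v) n = y at *
    simp only [tr, mul_apply_two, inv00, inv01, inv10, inv11, h1, h2, h3, h4]
    linear_combination (4 * x ^ 2 + 4 * x * y * (v 0 0 + v 1 1)) * hd
  have hy : 0 < (cheb (tr v) n ^ 2) ^ 2 := by positivity
  rw [Crosses, Crosses, tr_conj, tr_conj, disc_conj, disc_conj, key, disc_pow, mul_pow,
    show cheb (tr v) n ^ 2 * disc v * (cheb (tr v) n ^ 2 * disc v) =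
      (cheb (tr v) n ^ 2) ^ 2 * (disc v * disc v) by ring]
  exact mul_lt_mul_iff_right₀ hy

lemma abs_cheb_succ {t : ℤ} (ht : 3 ≤ |t|) (n : ℕ) :
    |cheb t n| + 1 ≤ |cheb t (n + 1)| := by
  induction n with
  | zero => simp [cheb]
  | succ n ih =>
    have h1 : |t * cheb t (n + 1)| - |cheb t n| ≤ |t * cheb t (n + 1) - cheb t n| :=
      abs_sub_abs_le_abs_sub _ _
    rw [abs_mul] at h1
    have h2 := abs_nonneg (cheb t n)
    rw [cheb]
    nlinarith

lemma le_abs_cheb {t : ℤ} (ht : 3 ≤ |t|) (n : ℕ) : (n : ℤ) ≤ |cheb t n| := by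
  induction n with
  | zero => simp [cheb]
  | succ n ih => push_cast; linarith [abs_cheb_succ ht n]

lemma three_le_abs_tr {g : SL2Z} (hg : 0 < disc g) : 3 ≤ |tr g| := by
  rw [disc, sub_pos, show (4 : ℤ) = 2 ^ 2 by norm_num, sq_lt_sq, abs_two] at hg
  exact hg

lemma cheb_ne_zero {g : SL2Z} (hg : 0 < disc g) {n : ℕ} (hn : n ≠ 0) :
    cheb (tr g) n ≠ 0 := by
  intro h
  have := le_abs_cheb (three_le_abs_tr hg) n
  rw [h, abs_zero] at this
  omega

lemma disc_pos_of_pow {g : SL2Z} {n : ℕ} (h : 0 < disc (g ^ n)) : 0 < disc g := by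
  rw [disc_pow] at h
  exact pos_of_mul_pos_right h (sq_nonneg _)

lemma exponent_le {g : SL2Z} {n : ℕ} (h : 0 < disc (g ^ n)) : (n : ℤ) ≤ disc (g ^ n) := by
  have hg := disc_pos_of_pow h
  have h1 := le_abs_cheb (three_le_abs_tr hg) n
  rw [disc_pow, ← sq_abs]
  calc (n : ℤ) ≤ |cheb (tr g) n| := h1
    _ ≤ |cheb (tr g) n| ^ 2 := Int.le_self_sq _
    _ ≤ |cheb (tr g) n| ^ 2 * disc g := le_mul_of_one_le_right (sq_nonneg _) hg

lemma exists_root_decomposition {g : Gamma} (hg : 0 < disc (g : SL2Z)) :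
    ∃ p : Gamma × ℕ, 1 ≤ p.2 ∧ NotProperPower p.1 ∧ g = p.1 ^ p.2 := by
  let P : ℕ → Prop := fun k => 1 ≤ k ∧ ∃ u : Gamma, g = u ^ k
  have hbd : ∀ k, P k → k ≤ (disc (g : SL2Z)).toNat := by
    rintro k ⟨-, u, rfl⟩
    rw [Subgroup.coe_pow] at hg ⊢
    have := exponent_le hg
    omega
  have h0 : P 1 := ⟨le_rfl, g, (pow_one g).symm⟩
  obtain ⟨h1, u, hu⟩ := Nat.findGreatest_spec (hbd 1 h0) h0
  refine ⟨(u, _), h1, ?_, hu⟩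
  rintro ⟨u', m, hm, hu'⟩
  have hP : P (m * Nat.findGreatest P (disc (g : SL2Z)).toNat) :=
    ⟨by nlinarith, u', by rw [pow_mul, ← hu']; exact hu⟩
  have := Nat.le_findGreatest (hbd _ hP) hP
  nlinarith

/-! ### Fixed points -/

/-- `r` is a root of the fixed-point quadratic of `g`. -/
def IsRoot (g : SL2Z) (r : ℝ) : Prop :=
  entry g 1 0 * r ^ 2 + (entry g 1 1 - entry g 0 0) * r - entry g 0 1 = 0

lemma entry_eq (g : SL2Z) (i j : Fin 2) : entry g i j = ((g i j : ℤ) : ℝ) := rfl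

lemma entry_det (g : SL2Z) : entry g 0 0 * entry g 1 1 - entry g 0 1 * entry g 1 0 = 1 := by
  simp only [entry_eq]; exact_mod_cast det_eq g

lemma entry_lower_left_ne_zero {g : SL2Z} (hg : 0 < disc g) : entry g 1 0 ≠ 0 := by
  rw [entry_eq]; exact_mod_cast lower_left_ne_zero hg

lemma entry_disc (g : SL2Z) : ((disc g : ℤ) : ℝ) =
    (entry g 0 0 - entry g 1 1) ^ 2 + 4 * (entry g 0 1 * entry g 1 0) := by
  rw [disc_eq]; simp only [entry_eq]; push_cast; ring

lemma isRoot_vieta {g : SL2Z} {r s : ℝ} (hrs : r ≠ s) (hr : IsRoot g r) (hs : IsRoot g s) :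
    entry g 0 0 = entry g 1 1 + entry g 1 0 * (r + s) ∧
      entry g 0 1 = - (entry g 1 0 * (r * s)) := by
  rw [IsRoot] at hr hs
  have h1 : entry g 0 0 = entry g 1 1 + entry g 1 0 * (r + s) := by
    apply mul_left_cancel₀ (sub_ne_zero.2 hrs)
    linear_combination hs - hr
  refine ⟨h1, ?_⟩
  rw [h1] at hr
  linear_combination - hr

lemma exists_isRoot {g : SL2Z} (hg : 0 < disc g) :
    ∃ r s : ℝ, r ≠ s ∧ IsRoot g r ∧ IsRoot g s := by
  have hc := entry_lower_left_ne_zero hg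
  have hD : (0 : ℝ) < disc g := by exact_mod_cast hg
  have hs : √(disc g : ℝ) ^ 2 = disc g := Real.sq_sqrt hD.le
  rw [entry_disc] at hs
  have hpos := Real.sqrt_pos.2 hD
  rw [entry_disc] at hpos
  generalize √((entry g 0 0 - entry g 1 1) ^ 2 + 4 * (entry g 0 1 * entry g 1 0)) = x at hs hpos
  refine ⟨(entry g 0 0 - entry g 1 1 + x) / (2 * entry g 1 0),
    (entry g 0 0 - entry g 1 1 - x) / (2 * entry g 1 0), ?_, ?_, ?_⟩
  · intro h
    rw [div_left_inj' (by positivity)] at h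
    linarith
  · rw [IsRoot]; field_simp; linear_combination hs
  · rw [IsRoot]; field_simp; linear_combination hs

lemma fixedSet_eq {g : SL2Z} (hg : 0 < disc g) {r s : ℝ} (hrs : r ≠ s) (hr : IsRoot g r)
    (hs : IsRoot g s) : fixedSet g = {(r : OnePoint ℝ), (s : OnePoint ℝ)} := by
  have hc := entry_lower_left_ne_zero hg
  have hd := entry_det g
  obtain ⟨v1, v2⟩ := isRoot_vieta hrs hr hs
  ext p
  rw [fixedSet, Set.mem_ofPred_eq, Set.mem_insert_iff, Set.mem_singleton_iff]
  induction p using OnePoint.rec with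
  | infty =>
    have : mobius g OnePoint.infty = ((entry g 0 0 / entry g 1 0 : ℝ) : OnePoint ℝ) :=
      if_neg hc
    rw [this]
    simp
  | coe x =>
    have : mobius g (x : OnePoint ℝ) = if entry g 1 0 * x + entry g 1 1 = 0 then OnePoint.infty
      else (((entry g 0 0 * x + entry g 0 1) / (entry g 1 0 * x + entry g 1 1) : ℝ) :
        OnePoint ℝ) := rfl
    rw [this, OnePoint.coe_eq_coe, OnePoint.coe_eq_coe]
    split_ifs with h
    · simp only [OnePoint.infty_ne_coe, false_iff]
      rintro (rfl | rfl)
      · rw [IsRoot] at hr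
        have h2 : entry g 0 0 * x + entry g 0 1 = 0 := by linear_combination x * h - hr
        have : (1 : ℝ) = 0 := by
          linear_combination -hd + entry g 0 0 * h - entry g 1 0 * h2
        exact one_ne_zero this
      · rw [IsRoot] at hs
        have h2 : entry g 0 0 * x + entry g 0 1 = 0 := by linear_combination x * h - hs
        have : (1 : ℝ) = 0 := by
          linear_combination -hd + entry g 0 0 * h - entry g 1 0 * h2
        exact one_ne_zero this
    · rw [OnePoint.coe_eq_coe, div_eq_iff h, v1, v2]
      have : (entry g 1 1 + entry g 1 0 * (r + s)) * x + -(entry g 1 0 * (r * s)) =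
          x * (entry g 1 0 * x + entry g 1 1) ↔ entry g 1 0 * ((x - r) * (x - s)) = 0 := by
        constructor <;> intro h <;> linear_combination -h
      rw [this, mul_eq_zero, or_iff_right hc, mul_eq_zero, sub_eq_zero, sub_eq_zero]

/-- Crossing is decided by the sign of the cross product of root differences. -/
lemma crosses_iff {g h : SL2Z} (hg : 0 < disc g) (hh : 0 < disc h) {r₁ r₂ s₁ s₂ : ℝ}
    (hr : r₁ ≠ r₂) (hs : s₁ ≠ s₂) (hr₁ : IsRoot g r₁) (hr₂ : IsRoot g r₂) (hs₁ : IsRoot h s₁)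
    (hs₂ : IsRoot h s₂) :
    Crosses g h ↔ ((r₁ - s₁) * (r₁ - s₂)) * ((r₂ - s₁) * (r₂ - s₂)) < 0 := by
  have hc := entry_lower_left_ne_zero hg
  have hc' := entry_lower_left_ne_zero hh
  obtain ⟨v1, v2⟩ := isRoot_vieta hr hr₁ hr₂
  obtain ⟨u1, u2⟩ := isRoot_vieta hs hs₁ hs₂
  have d1 := entry_disc g
  have d2 := entry_disc h
  have t1 : ((2 * tr (g * h) - tr g * tr h : ℤ) : ℝ) =
      (entry g 0 0 - entry g 1 1) * (entry h 0 0 - entry h 1 1) +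
        2 * (entry g 0 1 * entry h 1 0 + entry g 1 0 * entry h 0 1) := by
    simp only [tr, mul_apply_two, entry_eq]; push_cast; ring
  have key : ((2 * tr (g * h) - tr g * tr h : ℤ) : ℝ) ^ 2 - (disc g : ℝ) * disc h =
      4 * (entry g 1 0 * entry h 1 0) ^ 2 *
        (((r₁ - s₁) * (r₁ - s₂)) * ((r₂ - s₁) * (r₂ - s₂))) := by
    rw [t1, d1, d2, v1, v2, u1, u2]; ring
  have hpos : 0 < 4 * (entry g 1 0 * entry h 1 0) ^ 2 := by positivity
  rw [Crosses, ← @Int.cast_lt ℝ, ← sub_neg]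
  push_cast at key ⊢
  rw [key]
  exact ⟨fun h => neg_of_mul_neg_right h hpos.le, mul_neg_of_pos_of_neg hpos⟩

/-- A hyperbolic element of `SL₂(ℤ)` has no rational fixed point. -/
lemma isRoot_irrational {g : SL2Z} (hg : 0 < disc g) {r : ℝ} (hr : IsRoot g r) :
    Irrational r := by
  rintro ⟨q, rfl⟩
  have h1 : (disc g : ℝ) = (2 * entry g 1 0 * q + (entry g 1 1 - entry g 0 0)) ^ 2 := by
    rw [entry_disc]; rw [IsRoot] at hr; linear_combination (-4 * entry g 1 0) * hr
  have h2 : ((disc g : ℤ) : ℚ) = (2 * (g 1 0 : ℤ) * q + ((g 1 1 : ℤ) - (g 0 0 : ℤ))) ^ 2 := by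
    simp only [entry_eq] at h1; exact_mod_cast h1
  have h3 : IsSquare ((disc g : ℤ) : ℚ) := ⟨_, h2.trans (sq _)⟩
  rw [Rat.isSquare_intCast_iff] at h3
  obtain ⟨x, hx⟩ := h3
  have h5 := three_le_abs_tr hg
  rw [disc, ← sq_abs] at hx
  rw [← abs_mul_abs_self x] at hx
  have hx0 := abs_nonneg x
  generalize |x| = y at *
  generalize |tr g| = t at *
  have : y < t := by nlinarith
  have h6 : y ≤ t - 1 := by omega
  nlinarith

lemma isRoot_of_common {g h : SL2Z} (hg : 0 < disc g) {r s : ℝ}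
    (hr : IsRoot g r) (hr' : IsRoot h r) (hs : IsRoot g s) : IsRoot h s := by
  have hc := entry_lower_left_ne_zero hg
  have hirr := isRoot_irrational hg hr
  rw [IsRoot] at *
  have h1 : ((h 1 0 * (g 1 1 - g 0 0) - g 1 0 * (h 1 1 - h 0 0) : ℤ) : ℝ) * r +
      ((g 1 0 * h 0 1 - h 1 0 * g 0 1 : ℤ) : ℝ) = 0 := by
    simp only [entry_eq] at hr hr'
    push_cast
    linear_combination (h 1 0 : ℝ) * hr - (g 1 0 : ℝ) * hr'
  by_cases h2 : h 1 0 * (g 1 1 - g 0 0) - g 1 0 * (h 1 1 - h 0 0) = 0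
  · rw [h2, Int.cast_zero, zero_mul, zero_add] at h1
    have h2' : entry h 1 0 * (entry g 1 1 - entry g 0 0) -
        entry g 1 0 * (entry h 1 1 - entry h 0 0) = 0 := by
      simp only [entry_eq]; exact_mod_cast h2
    have h1' : entry g 1 0 * entry h 0 1 - entry h 1 0 * entry g 0 1 = 0 := by
      simp only [entry_eq]; exact_mod_cast h1
    apply mul_left_cancel₀ hc
    linear_combination entry h 1 0 * hs - s * h2' - h1'
  · exfalso
    have := ((hirr.intCast_mul h2).add_intCast (g 1 0 * h 0 1 - h 1 0 * g 0 1)).ne_zero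
    exact this h1

/-! ### Linked pairs of points on the circle -/

lemma isPreconnected_insert_infty_Iio (r : ℝ) :
    IsPreconnected (insert OnePoint.infty ((↑) '' Set.Iio r : Set (OnePoint ℝ))) := by
  refine (isPreconnected_Iio.image _ OnePoint.continuous_coe.continuousOn).subset_closure
    (Set.subset_insert _ _) (Set.insert_subset ?_ subset_closure)
  have h : Filter.Tendsto ((↑) : ℝ → OnePoint ℝ) Filter.atBot (nhds OnePoint.infty) :=
    (OnePoint.tendsto_coe_infty (X := ℝ)).mono_left (by
      rw [Filter.coclosedCompact_eq_cocompact]; exact atBot_le_cocompact)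
  exact mem_closure_of_tendsto h
    ((Filter.eventually_lt_atBot r).mono fun x hx => Set.mem_image_of_mem _ hx)

lemma isPreconnected_insert_infty_Ioi (r : ℝ) :
    IsPreconnected (insert OnePoint.infty ((↑) '' Set.Ioi r : Set (OnePoint ℝ))) := by
  refine (isPreconnected_Ioi.image _ OnePoint.continuous_coe.continuousOn).subset_closure
    (Set.subset_insert _ _) (Set.insert_subset ?_ subset_closure)
  have h : Filter.Tendsto ((↑) : ℝ → OnePoint ℝ) Filter.atTop (nhds OnePoint.infty) :=
    (OnePoint.tendsto_coe_infty (X := ℝ)).mono_left (by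
      rw [Filter.coclosedCompact_eq_cocompact]; exact atTop_le_cocompact)
  exact mem_closure_of_tendsto h
    ((Filter.eventually_gt_atTop r).mono fun x hx => Set.mem_image_of_mem _ hx)

lemma isPreconnected_outer (r₁ r₂ : ℝ) :
    IsPreconnected (insert OnePoint.infty ((↑) '' Set.Iio r₁) ∪
      insert OnePoint.infty ((↑) '' Set.Ioi r₂) : Set (OnePoint ℝ)) :=
  (isPreconnected_insert_infty_Iio r₁).union OnePoint.infty (Set.mem_insert _ _)
    (Set.mem_insert _ _) (isPreconnected_insert_infty_Ioi r₂)

lemma component_eq_of_preconnected {X : Type*} [TopologicalSpace X] {S U : Set X}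
    (hU : IsPreconnected U) (hUS : U ⊆ S) {x y : X} (hx : x ∈ U) (hy : y ∈ U) :
    connectedComponentIn S x = connectedComponentIn S y :=
  connectedComponentIn_eq (hU.subset_connectedComponentIn hx hUS hy)

lemma component_ne_iff {r₁ r₂ s₁ s₂ : ℝ} (hr : r₁ < r₂)
    (hshare : (s₁ = r₁ ∨ s₁ = r₂) ↔ (s₂ = r₁ ∨ s₂ = r₂)) :
    connectedComponentIn ({(r₁ : OnePoint ℝ), (r₂ : OnePoint ℝ)} : Set (OnePoint ℝ))ᶜ s₁ ≠
      connectedComponentIn ({(r₁ : OnePoint ℝ), (r₂ : OnePoint ℝ)} : Set (OnePoint ℝ))ᶜ s₂ ↔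
    ((r₁ - s₁) * (r₁ - s₂)) * ((r₂ - s₁) * (r₂ - s₂)) < 0 := by
  set S : Set (OnePoint ℝ) := ({(r₁ : OnePoint ℝ), (r₂ : OnePoint ℝ)} : Set (OnePoint ℝ))ᶜ
    with hS
  set U : Set (OnePoint ℝ) := (↑) '' Set.Ioo r₁ r₂ with hU
  set V : Set (OnePoint ℝ) := insert OnePoint.infty ((↑) '' Set.Iio r₁) ∪
      insert OnePoint.infty ((↑) '' Set.Ioi r₂) with hV
  have memU : ∀ x : ℝ, (x : OnePoint ℝ) ∈ U ↔ r₁ < x ∧ x < r₂ := by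
    intro x; simp [hU]
  have memV : ∀ x : ℝ, (x : OnePoint ℝ) ∈ V ↔ x < r₁ ∨ r₂ < x := by
    intro x; simp [hV]
  have memS : ∀ x : ℝ, (x : OnePoint ℝ) ∈ S ↔ x ≠ r₁ ∧ x ≠ r₂ := by
    intro x; simp [hS]
  have hUS : U ⊆ S := by
    rintro _ ⟨x, ⟨h1, h2⟩, rfl⟩
    exact (memS x).2 ⟨h1.ne', h2.ne⟩
  have hVS : V ⊆ S := by
    rintro p hp
    induction p using OnePoint.rec with
    | infty => simp [hS]
    | coe x =>
      rw [memV] at hp; rw [memS]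
      rcases hp with h | h <;> constructor <;> intro hh <;> linarith
  have hUo : IsOpen U := OnePoint.isOpen_image_coe.2 isOpen_Ioo
  have hVo : IsOpen V := by
    have : V = ((↑) '' Set.Icc r₁ r₂ : Set (OnePoint ℝ))ᶜ := by
      ext p
      induction p using OnePoint.rec with
      | infty => simp [hV]
      | coe x =>
        rw [memV]
        simp only [Set.mem_compl_iff, Set.mem_image, OnePoint.coe_eq_coe, exists_eq_right,
          Set.mem_Icc, not_and_or, not_le]
    rw [this]
    exact OnePoint.isOpen_compl_image_coe.2 ⟨isClosed_Icc, isCompact_Icc⟩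
  have hSUV : S ⊆ U ∪ V := by
    intro p hp
    induction p using OnePoint.rec with
    | infty => right; simp [hV]
    | coe x =>
      rw [memS] at hp
      rw [Set.mem_union, memU, memV]
      rcases lt_or_gt_of_ne hp.1 with h | h
      · exact Or.inr (Or.inl h)
      · rcases lt_or_gt_of_ne hp.2 with h' | h'
        · exact Or.inl ⟨h, h'⟩
        · exact Or.inr (Or.inr h')
  have hdisj : Disjoint U V := by
    rw [Set.disjoint_left]
    rintro _ ⟨x, ⟨h1, h2⟩, rfl⟩ h
    rw [memV] at h
    rcases h with h | h <;> linarith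
  have hsep : ∀ x y : ℝ, (x : OnePoint ℝ) ∈ U → (y : OnePoint ℝ) ∈ V →
      connectedComponentIn S x ≠ connectedComponentIn S y := by
    intro x y hx hy h
    have h1 : connectedComponentIn S (x : OnePoint ℝ) ⊆ U :=
      isPreconnected_connectedComponentIn.subset_left_of_subset_union hUo hVo hdisj
        ((connectedComponentIn_subset _ _).trans hSUV)
        ⟨x, mem_connectedComponentIn (hUS hx), hx⟩
    have h2 : (y : OnePoint ℝ) ∈ connectedComponentIn S (x : OnePoint ℝ) := by
      rw [h]; exact mem_connectedComponentIn (hVS hy)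
    exact Set.disjoint_left.1 hdisj (h1 h2) hy
  have hrw : (r₁ - s₁) * (r₁ - s₂) * ((r₂ - s₁) * (r₂ - s₂)) =
      ((r₁ - s₁) * (r₂ - s₁)) * ((r₁ - s₂) * (r₂ - s₂)) := by ring
  have negU : ∀ x : ℝ, (x : OnePoint ℝ) ∈ U → (r₁ - x) * (r₂ - x) < 0 := by
    intro x hx
    rw [memU] at hx
    exact mul_neg_of_neg_of_pos (by linarith) (by linarith)
  have posV : ∀ x : ℝ, (x : OnePoint ℝ) ∈ V → 0 < (r₁ - x) * (r₂ - x) := by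
    intro x hx
    rw [memV] at hx
    rcases hx with hx | hx
    · exact mul_pos (by linarith) (by linarith)
    · exact mul_pos_of_neg_of_neg (by linarith) (by linarith)
  rw [hrw]
  by_cases h1 : (s₁ : OnePoint ℝ) ∈ S
  · have h2 : (s₂ : OnePoint ℝ) ∈ S := by
      rw [memS, ← not_or] at h1 ⊢
      rwa [← hshare]
    rcases hSUV h1 with h1 | h1 <;> rcases hSUV h2 with h2 | h2
    · exact iff_of_false (not_not.2 (component_eq_of_preconnected
        (isPreconnected_Ioo.image _ OnePoint.continuous_coe.continuousOn) hUS h1 h2))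
        (mul_pos_of_neg_of_neg (negU _ h1) (negU _ h2)).not_gt
    · exact iff_of_true (hsep _ _ h1 h2) (mul_neg_of_neg_of_pos (negU _ h1) (posV _ h2))
    · exact iff_of_true (hsep _ _ h2 h1).symm (mul_neg_of_pos_of_neg (posV _ h1) (negU _ h2))
    · exact iff_of_false (not_not.2 (component_eq_of_preconnected
        (isPreconnected_outer r₁ r₂) hVS h1 h2)) (mul_pos (posV _ h1) (posV _ h2)).not_gt
  · have h2 : (s₂ : OnePoint ℝ) ∉ S := by
      rw [memS, ← not_or, not_not] at h1 ⊢
      rwa [← hshare]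
    refine iff_of_false ?_ ?_
    · rw [connectedComponentIn_eq_empty h1, connectedComponentIn_eq_empty h2]
      exact fun h => h rfl
    · rw [memS, ← not_or, not_not] at h1
      rcases h1 with rfl | rfl <;> simp

lemma linked_iff {r₁ r₂ s₁ s₂ : ℝ} (hr : r₁ < r₂) (hs : s₁ ≠ s₂)
    (hshare : (s₁ = r₁ ∨ s₁ = r₂) ↔ (s₂ = r₁ ∨ s₂ = r₂)) :
    Linked {(r₁ : OnePoint ℝ), (r₂ : OnePoint ℝ)} {(s₁ : OnePoint ℝ), (s₂ : OnePoint ℝ)} ↔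
      ((r₁ - s₁) * (r₁ - s₂)) * ((r₂ - s₁) * (r₂ - s₂)) < 0 := by
  rw [← component_ne_iff hr hshare, Linked]
  constructor
  · rintro ⟨q₁, q₂, -, hq, h⟩
    rcases Set.pair_eq_pair_iff.1 hq with ⟨rfl, rfl⟩ | ⟨rfl, rfl⟩
    · exact h
    · exact h.symm
  · exact fun h => ⟨s₁, s₂, fun h' => hs (OnePoint.coe_eq_coe.1 h'), rfl, h⟩

lemma linked_fixedSet_iff {g h : SL2Z} (hg : 0 < disc g) (hh : 0 < disc h) :
    Linked (fixedSet g) (fixedSet h) ↔ Crosses g h := by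
  obtain ⟨r₁, r₂, hr, hr₁, hr₂⟩ : ∃ r s : ℝ, r < s ∧ IsRoot g r ∧ IsRoot g s := by
    obtain ⟨r, s, hrs, hr, hs⟩ := exists_isRoot hg
    rcases lt_or_gt_of_ne hrs with h | h
    · exact ⟨r, s, h, hr, hs⟩
    · exact ⟨s, r, h, hs, hr⟩
  obtain ⟨s₁, s₂, hs, hs₁, hs₂⟩ := exists_isRoot hh
  have mem_of_common : ∀ s t : ℝ, IsRoot h s → IsRoot h t → (s = r₁ ∨ s = r₂) →
      (t = r₁ ∨ t = r₂) := by
    intro s t hs ht hst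
    have hgs : IsRoot g s := by rcases hst with rfl | rfl <;> assumption
    have hgt := isRoot_of_common hh hs hgs ht
    have : (t : OnePoint ℝ) ∈ fixedSet g := by
      by_contra hne
      have hr₁' : t ≠ r₁ := by
        rintro rfl
        rw [fixedSet_eq hg hr.ne hr₁ hr₂] at hne
        simp at hne
      rw [fixedSet_eq hg hr₁' hgt hr₁] at hne
      simp at hne
    rw [fixedSet_eq hg hr.ne hr₁ hr₂] at this
    simpa using this
  rw [crosses_iff hg hh hr.ne hs hr₁ hr₂ hs₁ hs₂, fixedSet_eq hg hr.ne hr₁ hr₂,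
    fixedSet_eq hh hs hs₁ hs₂]
  exact linked_iff hr hs ⟨mem_of_common _ _ hs₁ hs₂, mem_of_common _ _ hs₂ hs₁⟩

lemma goodConj_iff (v h : Gamma) : GoodConj v h ↔
    0 < disc (v : SL2Z) ∧ Crosses (v : SL2Z) ((h : SL2Z) * v * (h : SL2Z)⁻¹) := by
  have h1 : ((h * v * h⁻¹ : Gamma) : SL2Z) = (h : SL2Z) * v * (h : SL2Z)⁻¹ := rfl
  rw [GoodConj, hyperbolic_iff, hyperbolic_iff, h1, disc_conj]
  constructor
  · rintro ⟨h2, -, h3⟩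
    exact ⟨h2, (linked_fixedSet_iff h2 (by rwa [disc_conj])).1 h3⟩
  · rintro ⟨h2, h3⟩
    exact ⟨h2, h2, (linked_fixedSet_iff h2 (by rwa [disc_conj])).2 h3⟩

/-! ### Finiteness of the set of linked double cosets -/

lemma zpow_mul_semiconj {v : SL2Z} {f : SL2Z → ℝ} {a : ℝ} (ha : a ≠ 0)
    (hf : ∀ h, f (v * h) = a * f h) (m : ℤ) (h : SL2Z) : f (v ^ m * h) = a ^ m * f h := by
  induction m with
  | zero => simp
  | succ n ih => rw [add_comm, zpow_add, zpow_one, mul_assoc, hf, ih, zpow_add₀ ha, zpow_one,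
      mul_assoc]
  | pred n ih =>
    have h1 : v * (v ^ (-(n : ℤ) - 1) * h) = v ^ (-(n : ℤ)) * h := by group
    apply mul_left_cancel₀ ha
    rw [← hf, h1, ih, zpow_sub_one₀ ha]
    field_simp

lemma mul_zpow_semiconj {v : SL2Z} {f : SL2Z → ℝ} {a : ℝ} (ha : a ≠ 0)
    (hf : ∀ h, f (h * v) = a * f h) (m : ℤ) (h : SL2Z) : f (h * v ^ m) = a ^ m * f h := by
  induction m with
  | zero => simp
  | succ n ih => rw [zpow_add, zpow_one, ← mul_assoc, hf, ih, zpow_add₀ ha, zpow_one]; ring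
  | pred n ih =>
    have h1 : h * v ^ (-(n : ℤ) - 1) * v = h * v ^ (-(n : ℤ)) := by group
    apply mul_left_cancel₀ ha
    rw [← hf, h1, ih, zpow_sub_one₀ ha]
    field_simp

lemma exists_expanding_root {v : SL2Z} (hv : 0 < disc v) : ∃ r s : ℝ, r ≠ s ∧ IsRoot v r ∧
    IsRoot v s ∧ 1 < |entry v 1 0 * r + entry v 1 1| ∧
    (entry v 1 0 * r + entry v 1 1) * (entry v 1 0 * s + entry v 1 1) = 1 := by
  obtain ⟨r, s, hrs, hr, hs⟩ := exists_isRoot hv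
  obtain ⟨v1, v2⟩ := isRoot_vieta hrs hr hs
  have hd := entry_det v
  have hmul : (entry v 1 0 * r + entry v 1 1) * (entry v 1 0 * s + entry v 1 1) = 1 := by
    rw [v1, v2] at hd; linear_combination hd
  have hne : (entry v 1 0 * r + entry v 1 1) - (entry v 1 0 * s + entry v 1 1) ≠ 0 := by
    have := mul_ne_zero (entry_lower_left_ne_zero hv) (sub_ne_zero.2 hrs)
    intro h; apply this; linear_combination h
  generalize hx : entry v 1 0 * r + entry v 1 1 = x at *
  generalize hy : entry v 1 0 * s + entry v 1 1 = y at *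
  have habs : |x| * |y| = 1 := by rw [← abs_mul, hmul, abs_one]
  rcases lt_trichotomy 1 |x| with h | h | h
  · exact ⟨r, s, hrs, hr, hs, by rwa [hx], by rw [hx, hy, hmul]⟩
  · exfalso
    have hxx : x * x = 1 := by rw [← abs_mul_abs_self, ← h, one_mul]
    apply hne
    have hx0 : x ≠ 0 := by rintro rfl; simp at hxx
    apply mul_left_cancel₀ hx0
    linear_combination hxx - hmul
  · refine ⟨s, r, hrs.symm, hs, hr, ?_, by rw [hx, hy, mul_comm, hmul]⟩
    rw [hy]
    nlinarith [abs_nonneg x, abs_nonneg y]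

lemma tr_mul_conj (v h : SL2Z) {r s : ℝ} (v1 : entry v 0 0 = entry v 1 1 + entry v 1 0 * (r + s))
    (v2 : entry v 0 1 = - (entry v 1 0 * (r * s))) :
    ((tr (v * (h * v * h⁻¹)) : ℤ) : ℝ) = 2 + (entry v 1 0) ^ 2 *
      (((entry h 0 0 * r + entry h 0 1) - s * (entry h 1 0 * r + entry h 1 1)) *
      (r * (entry h 1 0 * s + entry h 1 1) - (entry h 0 0 * s + entry h 0 1))) := by
  have hd := entry_det v
  have hd' := entry_det h
  have h2 : ((tr (v * (h * v * h⁻¹)) : ℤ) : ℝ) =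
    entry v 0 0 * ((entry h 0 0 * entry v 0 0 + entry h 0 1 * entry v 1 0) * entry h 1 1 +
      (entry h 0 0 * entry v 0 1 + entry h 0 1 * entry v 1 1) * (-entry h 1 0)) +
    entry v 0 1 * ((entry h 1 0 * entry v 0 0 + entry h 1 1 * entry v 1 0) * entry h 1 1 +
      (entry h 1 0 * entry v 0 1 + entry h 1 1 * entry v 1 1) * (-entry h 1 0)) +
    (entry v 1 0 * ((entry h 0 0 * entry v 0 0 + entry h 0 1 * entry v 1 0) *
        (-entry h 0 1) +
      (entry h 0 0 * entry v 0 1 + entry h 0 1 * entry v 1 1) * entry h 0 0) +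
    entry v 1 1 * ((entry h 1 0 * entry v 0 0 + entry h 1 1 * entry v 1 0) *
        (-entry h 0 1) +
      (entry h 1 0 * entry v 0 1 + entry h 1 1 * entry v 1 1) * entry h 0 0)) := by
    simp only [tr, mul_apply_two, inv00, inv01, inv10, inv11, entry_eq]
    push_cast; ring
  have h1 : ((tr (v * (h * v * h⁻¹)) : ℤ) : ℝ) =
      2 * ((entry v 0 0 * entry v 1 1 - entry v 0 1 * entry v 1 0) *
        (entry h 0 0 * entry h 1 1 - entry h 0 1 * entry h 1 0)) + (entry v 1 0) ^ 2 *
      (((entry h 0 0 * r + entry h 0 1) - s * (entry h 1 0 * r + entry h 1 1)) *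
      (r * (entry h 1 0 * s + entry h 1 1) - (entry h 0 0 * s + entry h 0 1))) := by
    rw [h2, v1, v2]; ring
  rw [h1, hd, hd', mul_one, mul_one]

lemma crosses_coordinates {v h : SL2Z} (hv : 0 < disc v) {r s : ℝ} (hrs : r ≠ s)
    (hr : IsRoot v r) (hs : IsRoot v s) (hc : Crosses v (h * v * h⁻¹)) :
    0 < ((entry h 0 0 * r + entry h 0 1) - s * (entry h 1 0 * r + entry h 1 1)) *
      (r * (entry h 1 0 * s + entry h 1 1) - (entry h 0 0 * s + entry h 0 1)) ∧
    ((entry h 0 0 * r + entry h 0 1) - s * (entry h 1 0 * r + entry h 1 1)) *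
      (r * (entry h 1 0 * s + entry h 1 1) - (entry h 0 0 * s + entry h 0 1)) < (r - s) ^ 2 := by
  obtain ⟨v1, v2⟩ := isRoot_vieta hrs hr hs
  have hc0 := entry_lower_left_ne_zero hv
  have hT := tr_mul_conj v h v1 v2
  have hD : ((disc v : ℤ) : ℝ) = (entry v 1 0) ^ 2 * (r - s) ^ 2 := by
    rw [entry_disc, v1, v2]; ring
  have ht : ((tr v : ℤ) : ℝ) ^ 2 = (disc v : ℤ) + 4 := by rw [disc]; push_cast; ring
  generalize ((entry h 0 0 * r + entry h 0 1) - s * (entry h 1 0 * r + entry h 1 1)) *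
      (r * (entry h 1 0 * s + entry h 1 1) - (entry h 0 0 * s + entry h 0 1)) = z at *
  rw [Crosses, tr_conj, disc_conj, ← @Int.cast_lt ℝ] at hc
  push_cast at hc
  have h3 : 2 * ((tr (v * (h * v * h⁻¹)) : ℤ) : ℝ) - tr v * tr v =
      (entry v 1 0) ^ 2 * (2 * z - (r - s) ^ 2) := by
    rw [← sq, ht, hT, hD]; ring
  rw [h3, hD] at hc
  have hpos : 0 < entry v 1 0 ^ 2 := by positivity
  have h4 : entry v 1 0 ^ 2 * entry v 1 0 ^ 2 * (4 * (z * (z - (r - s) ^ 2))) < 0 := by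
    linarith
  have h5 := neg_of_mul_neg_right h4 (by positivity)
  have h6 : 0 ≤ (r - s) ^ 2 := sq_nonneg _
  constructor <;> nlinarith

lemma abs_le_of_mul_lt {x y a : ℝ} (hx : 1 ≤ |x|) (h : |x * y| ≤ a) : |y| ≤ a := by
  rw [abs_mul] at h
  nlinarith [abs_nonneg y]

lemma entries_bounded (r s M : ℝ) (hrs : r ≠ s) : ∃ B : ℤ, ∀ h : SL2Z,
    |(entry h 0 0 * r + entry h 0 1) - s * (entry h 1 0 * r + entry h 1 1)| ≤ M →
    |(entry h 0 0 * s + entry h 0 1) - s * (entry h 1 0 * s + entry h 1 1)| ≤ M →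
    |r * (entry h 1 0 * r + entry h 1 1) - (entry h 0 0 * r + entry h 0 1)| ≤ M →
    |r * (entry h 1 0 * s + entry h 1 1) - (entry h 0 0 * s + entry h 0 1)| ≤ M →
    ∀ i j, |h i j| ≤ B := by
  have hδ : 0 < |r - s| := abs_pos.2 (sub_ne_zero.2 hrs)
  set Y := 2 * M / |r - s| with hY
  set X := (|r| * M + |s| * M) / |r - s| with hX
  set E := 2 * Y / |r - s| with hE
  set F := 2 * X / |r - s| with hF
  refine ⟨⌈F⌉ ⊔ ⌈X + F * |r|⌉ ⊔ (⌈E⌉ ⊔ ⌈Y + E * |r|⌉), ?_⟩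
  intro h h1 h2 h3 h4
  have bd : ∀ x y a : ℝ, (r - s) * x = y → |y| ≤ a → |x| ≤ a / |r - s| := by
    intro x y a hxy ha
    rw [le_div_iff₀ hδ, mul_comm, ← abs_mul, hxy]; exact ha
  have tri : ∀ x y a b : ℝ, |x| ≤ a → |y| ≤ b → |x + y| ≤ a + b := fun x y a b hx hy =>
    (abs_add_le x y).trans (add_le_add hx hy)
  have triS : ∀ x y a b : ℝ, |x| ≤ a → |y| ≤ b → |x - y| ≤ a + b := fun x y a b hx hy =>
    (abs_sub x y).trans (add_le_add hx hy)
  have ml : ∀ x y a : ℝ, |x| ≤ a → |y * x| ≤ |y| * a := fun x y a hx => by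
    rw [abs_mul]; exact mul_le_mul_of_nonneg_left hx (abs_nonneg _)
  have y1 := bd (entry h 1 0 * r + entry h 1 1) _ _ (by ring) (tri _ _ _ _ h1 h3)
  have y2 := bd (entry h 1 0 * s + entry h 1 1) _ _ (by ring) (tri _ _ _ _ h2 h4)
  have x1 := bd (entry h 0 0 * r + entry h 0 1) _ _ (by ring)
    (tri _ _ _ _ (ml _ r _ h1) (ml _ s _ h3))
  have x2 := bd (entry h 0 0 * s + entry h 0 1) _ _ (by ring)
    (tri _ _ _ _ (ml _ r _ h2) (ml _ s _ h4))
  rw [← two_mul, ← hY] at y1 y2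
  rw [← hX] at x1 x2
  have e10 := bd (entry h 1 0) _ _ (by ring) (triS _ _ _ _ y1 y2)
  have e00 := bd (entry h 0 0) _ _ (by ring) (triS _ _ _ _ x1 x2)
  rw [← two_mul, ← hE] at e10
  rw [← two_mul, ← hF] at e00
  have sub : ∀ e f a b : ℝ, |e * r + f| ≤ a → |e| ≤ b → |f| ≤ a + b * |r| := by
    intro e f a b h1 h2
    have h3 : |-(e * r)| ≤ b * |r| := by
      rw [abs_neg, abs_mul]; exact mul_le_mul_of_nonneg_right h2 (abs_nonneg _)
    have := tri _ _ _ _ h1 h3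
    rwa [show e * r + f + -(e * r) = f by ring] at this
  have e11 := sub _ _ _ _ y1 e10
  have e01 := sub _ _ _ _ x1 e00
  have fin : ∀ (n : ℤ) (a : ℝ), |(n : ℝ)| ≤ a → |n| ≤ ⌈a⌉ := by
    intro n a ha
    rw [← Int.cast_abs] at ha
    exact_mod_cast ha.trans (Int.le_ceil a)
  have b00 := fin _ _ e00
  have b01 := fin _ _ e01
  have b10 := fin _ _ e10
  have b11 := fin _ _ e11
  intro i j
  fin_cases i <;> fin_cases j <;> simp only [le_sup_iff]
  · exact Or.inl (Or.inl b00)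
  · exact Or.inl (Or.inr b01)
  · exact Or.inr (Or.inl b10)
  · exact Or.inr (Or.inr b11)

lemma crosses_double_coset (v h : SL2Z) (m k : ℤ) :
    Crosses v (v ^ m * h * v ^ k * v * (v ^ m * h * v ^ k)⁻¹) ↔ Crosses v (h * v * h⁻¹) := by
  have h1 : v ^ m * h * v ^ k * v * (v ^ m * h * v ^ k)⁻¹ =
      v ^ m * (h * v * h⁻¹) * (v ^ m)⁻¹ := by group
  have h2 : v ^ m * v * (v ^ m)⁻¹ = v := by group
  rw [h1]
  nth_rewrite 1 [← h2]
  exact crosses_conj _ _ _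

lemma exists_small_representative {v : SL2Z} (hv : 0 < disc v) : ∃ B : ℤ, ∀ h : SL2Z,
    Crosses v (h * v * h⁻¹) → ∃ m k : ℤ, ∀ i j, |(v ^ m * h * v ^ k) i j| ≤ B := by
  obtain ⟨r, s, hrs, hr, hs, hl, hlm⟩ := exists_expanding_root hv
  obtain ⟨v1, v2⟩ := isRoot_vieta hrs hr hs
  set l := entry v 1 0 * r + entry v 1 1 with hl_def
  set u := entry v 1 0 * s + entry v 1 1 with hu_def
  have hl0 : l ≠ 0 := fun h => by rw [h, abs_zero] at hl; linarith
  have hu0 : u ≠ 0 := fun h => by rw [h, mul_zero] at hlm; exact zero_ne_one hlm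
  have hu : u = l⁻¹ := eq_inv_of_mul_eq_one_right hlm
  obtain ⟨B, hB⟩ := entries_bounded r s (l ^ 2 + (r - s) ^ 2) hrs
  refine ⟨B, fun h hc => ?_⟩
  let p : SL2Z → ℝ := fun h =>
    (entry h 0 0 * r + entry h 0 1) - s * (entry h 1 0 * r + entry h 1 1)
  let q : SL2Z → ℝ := fun h =>
    (entry h 0 0 * s + entry h 0 1) - s * (entry h 1 0 * s + entry h 1 1)
  have emul : ∀ (g h : SL2Z) (i j : Fin 2), entry (g * h) i j =
      entry g i 0 * entry h 0 j + entry g i 1 * entry h 1 j := by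
    intro g h i j; simp only [entry_eq, mul_apply_two]; push_cast; ring
  have pl : ∀ h, p (v * h) = l * p h := by
    intro h; simp only [p, emul, v1, v2, hl_def]; ring
  have ql : ∀ h, q (v * h) = l * q h := by
    intro h; simp only [q, emul, v1, v2, hl_def]; ring
  have pr : ∀ h, p (h * v) = l * p h := by
    intro h; simp only [p, emul, v1, v2, hl_def]; ring
  have qr : ∀ h, q (h * v) = u * q h := by
    intro h; simp only [q, emul, v1, v2, hu_def]; ring
  have hall : ∀ h : SL2Z, Crosses v (h * v * h⁻¹) → p h ≠ 0 ∧ q h ≠ 0 ∧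
      |p h * (r * (entry h 1 0 * s + entry h 1 1) - (entry h 0 0 * s + entry h 0 1))| ≤
        (r - s) ^ 2 ∧
      |q h * (r * (entry h 1 0 * r + entry h 1 1) - (entry h 0 0 * r + entry h 0 1))| ≤
        (r - s) ^ 2 := by
    intro h hc
    obtain ⟨h1, h2⟩ := crosses_coordinates hv hrs hr hs hc
    have hd := entry_det h
    have h3 : q h * (r * (entry h 1 0 * r + entry h 1 1) - (entry h 0 0 * r + entry h 0 1)) =
        p h * (r * (entry h 1 0 * s + entry h 1 1) - (entry h 0 0 * s + entry h 0 1)) -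
          (r - s) ^ 2 := by
      simp only [p, q]; linear_combination (-(r - s) ^ 2) * hd
    refine ⟨left_ne_zero_of_mul h1.ne', fun hq => ?_, ?_, ?_⟩
    · rw [hq, zero_mul] at h3
      simp only [p] at h3
      linarith
    · rw [abs_of_pos h1]; exact h2.le
    · rw [h3, abs_le]
      simp only [p]
      constructor <;> linarith
  obtain ⟨hp0, hq0, -, -⟩ := hall h hc
  have hl2 : 1 < |l| ^ 2 := one_lt_pow₀ hl two_ne_zero
  obtain ⟨a, ha1, ha2⟩ := exists_mem_Ico_zpow (abs_pos.2 hp0) hl2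
  obtain ⟨b, hb1, hb2⟩ := exists_mem_Ico_zpow (abs_pos.2 hq0) hl2
  have hscale : ∀ (x : ℝ) (n : ℤ), (|l| ^ 2) ^ n ≤ |x| → |x| < (|l| ^ 2) ^ (n + 1) →
      1 ≤ |l| ^ (-2 * n) * |x| ∧ |l| ^ (-2 * n) * |x| ≤ l ^ 2 := by
    intro x n h1 h2
    have hlp : 0 < |l| := by linarith
    have h3 : |l| ^ (-2 * n) = ((|l| ^ 2) ^ n)⁻¹ := by
      rw [← zpow_natCast, ← zpow_mul, ← zpow_neg]; congr 1; push_cast; ring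
    have h4 : 0 < (|l| ^ 2) ^ n := by positivity
    rw [h3, ← sq_abs l]
    rw [zpow_add_one₀ (by positivity)] at h2
    constructor
    · rw [le_inv_mul_iff₀ h4, mul_one]; exact h1
    · rw [inv_mul_le_iff₀ h4]; exact h2.le
  set m : ℤ := -a - b
  set k : ℤ := b - a
  refine ⟨m, k, ?_⟩
  have hp' : |p (v ^ m * h * v ^ k)| = |l| ^ (-2 * a) * |p h| := by
    rw [mul_zpow_semiconj hl0 pr, zpow_mul_semiconj hl0 pl, ← mul_assoc, ← zpow_add₀ hl0,
      abs_mul, abs_zpow]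
    congr 2; simp only [m, k]; ring
  have hq' : |q (v ^ m * h * v ^ k)| = |l| ^ (-2 * b) * |q h| := by
    rw [mul_zpow_semiconj hu0 qr, zpow_mul_semiconj hl0 ql, hu, inv_zpow', ← mul_assoc,
      ← zpow_add₀ hl0, abs_mul, abs_zpow]
    congr 2; simp only [m, k]; ring
  obtain ⟨p1, p2⟩ := hscale _ _ ha1 ha2
  obtain ⟨q1, q2⟩ := hscale _ _ hb1 hb2
  rw [← hp'] at p1 p2
  rw [← hq'] at q1 q2
  obtain ⟨-, -, h3, h4⟩ := hall _ ((crosses_double_coset v h m k).2 hc)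
  have hl2' := sq_nonneg l
  have hd' := sq_nonneg (r - s)
  refine hB _ (p2.trans (by linarith)) (q2.trans (by linarith))
    ((abs_le_of_mul_lt q1 h4).trans (by linarith)) ((abs_le_of_mul_lt p1 h3).trans (by linarith))

lemma finite_bounded_entries (B : ℤ) : {h : SL2Z | ∀ i j, |h i j| ≤ B}.Finite := by
  have : (Set.Icc (fun _ _ => -B) (fun _ _ => B) : Set (Fin 2 → Fin 2 → ℤ)).Finite :=
    Set.finite_Icc _ _
  refine Set.Finite.of_injOn (f := fun (h : SL2Z) (i j : Fin 2) => h i j) ?_ ?_ this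
  · intro h hh
    exact ⟨fun i j => (abs_le.1 (hh i j)).1, fun i j => (abs_le.1 (hh i j)).2⟩
  · intro h _ h' _ hhh
    ext i j
    exact congrFun (congrFun hhh i) j

lemma finite_goodConj_quot (v : Gamma) :
    Finite (Quot (fun h h' : {h : Gamma // GoodConj v h} =>
      ∃ m k : ℤ, (h' : Gamma) = v ^ m * (h : Gamma) * v ^ k)) := by
  by_cases hv : 0 < disc (v : SL2Z)
  · obtain ⟨B, hB⟩ := exists_small_representative hv
    have hfin := (finite_bounded_entries B).to_subtype
    have hB' : ∀ h : {h : Gamma // GoodConj v h}, ∃ m k : ℤ, ∀ i j,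
        |((v : SL2Z) ^ m * ((h : Gamma) : SL2Z) * (v : SL2Z) ^ k) i j| ≤ B := fun h =>
      hB _ ((goodConj_iff v h).1 h.2).2
    choose m k hmk using hB'
    refine Finite.of_injective (β := {h : SL2Z | ∀ i j, |h i j| ≤ B})
      (fun x => ⟨_, hmk x.out⟩) ?_
    intro x y hxy
    have h1 : (v : SL2Z) ^ m x.out * ((x.out : Gamma) : SL2Z) * (v : SL2Z) ^ k x.out =
        (v : SL2Z) ^ m y.out * ((y.out : Gamma) : SL2Z) * (v : SL2Z) ^ k y.out :=
      congrArg Subtype.val hxy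
    have h2 : v ^ m x.out * (x.out : Gamma) * v ^ k x.out =
        v ^ m y.out * (y.out : Gamma) * v ^ k y.out := Subtype.ext h1
    rw [← x.out_eq, ← y.out_eq]
    refine Quot.sound ⟨-m y.out + m x.out, k x.out - k y.out, ?_⟩
    calc (y.out : Gamma)
        = v ^ (-m y.out) * (v ^ m y.out * (y.out : Gamma) * v ^ k y.out) * v ^ (-k y.out) := by
          group
      _ = v ^ (-m y.out) * (v ^ m x.out * (x.out : Gamma) * v ^ k x.out) * v ^ (-k y.out) := by
          rw [h2]
      _ = _ := by group
  · have : IsEmpty {h : Gamma // GoodConj v h} := ⟨fun h => hv ((goodConj_iff v h).1 h.2).1⟩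
    infer_instance

/-! ### Parity of the number of linked double cosets -/

lemma commute_of_sq_eq_one {x : SL2Z} (hx : x * x = 1) (v : SL2Z) : x * v = v * x := by
  obtain ⟨i1, i2, i3, i4⟩ := one_entries
  have hd := det_eq x
  rw [← hx] at i1 i2 i3 i4
  rw [mul_apply_two] at i1 i2 i3 i4
  have ht : x 0 0 + x 1 1 ≠ 0 := by
    intro h
    have h1 : x 1 1 = - x 0 0 := by linarith
    rw [h1] at hd
    linarith
  have h01 : x 0 1 = 0 := by
    apply (mul_eq_zero.1 (_ : (x 0 0 + x 1 1) * x 0 1 = 0)).resolve_left ht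
    linarith
  have h10 : x 1 0 = 0 := by
    apply (mul_eq_zero.1 (_ : (x 0 0 + x 1 1) * x 1 0 = 0)).resolve_left ht
    linarith
  have h11 : x 1 1 = x 0 0 := by
    rw [h01, h10] at hd
    rcases Int.mul_eq_one_iff_eq_one_or_neg_one.1 (by linarith : x 0 0 * x 1 1 = 1) with
      ⟨h1, h2⟩ | ⟨h1, h2⟩ <;> rw [h1, h2]
  apply ext_two <;> simp only [mul_apply_two, h01, h10, h11] <;> ring

lemma inv_ne_double_coset {v h : SL2Z} (hv : 0 < disc v) (hc : Crosses v (h * v * h⁻¹))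
    (m k : ℤ) : h⁻¹ ≠ v ^ m * h * v ^ k := by
  intro heq
  have h1 : h * v ^ k * (h * v ^ k) = v ^ (k - m) := by
    have h2 : h * v ^ k = v ^ (-m) * h⁻¹ := by rw [heq]; group
    calc h * v ^ k * (h * v ^ k) = v ^ (-m) * h⁻¹ * (h * v ^ k) := by rw [h2]
      _ = v ^ (k - m) := by group
  have h2 : h * v * h⁻¹ = (h * v ^ k) * v * (h * v ^ k)⁻¹ := by group
  rw [h2] at hc
  generalize h * v ^ k = x at *
  generalize k - m = e at *
  by_cases he : e = 0
  · rw [he, zpow_zero] at h1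
    rw [commute_of_sq_eq_one h1, mul_inv_cancel_right] at hc
    exact not_crosses_self v hc
  · have hcomm : Commute x (v ^ e) := by
      rw [← h1]; exact (Commute.refl x).mul_right (Commute.refl x)
    have hcomm' : Commute x (v ^ e.natAbs) := by
      rcases Int.natAbs_eq e with h | h
      · rw [h, zpow_natCast] at hcomm; exact hcomm
      · rw [h, zpow_neg, zpow_natCast] at hcomm; simpa using hcomm.inv_right
    rw [← crosses_pow_iff v x e.natAbs (cheb_ne_zero hv (Int.natAbs_ne_zero.2 he)), hcomm'.eq,
      mul_inv_cancel_right] at hc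
    exact not_crosses_self _ hc

lemma goodConj_inv {v h : Gamma} (hg : GoodConj v h) : GoodConj v h⁻¹ := by
  rw [goodConj_iff] at hg ⊢
  refine ⟨hg.1, ?_⟩
  have := crosses_inv_conj hg.2
  rwa [Subgroup.coe_inv, inv_inv]

lemma doubleCosetRel_equivalence (v : Gamma) :
    Equivalence (fun h h' : {h : Gamma // GoodConj v h} =>
      ∃ m k : ℤ, (h' : Gamma) = v ^ m * (h : Gamma) * v ^ k) where
  refl h := ⟨0, 0, by simp⟩
  symm := by
    rintro h h' ⟨m, k, e⟩
    exact ⟨-m, -k, by rw [e]; group⟩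
  trans := by
    rintro h h' h'' ⟨m, k, e⟩ ⟨m', k', e'⟩
    exact ⟨m' + m, k + k', by rw [e', e]; group⟩

lemma even_sTwo (v : Gamma) : 2 ∣ sTwo v := by
  have hfin := finite_goodConj_quot v
  rw [sTwo]
  set R := (fun h h' : {h : Gamma // GoodConj v h} =>
      ∃ m k : ℤ, (h' : Gamma) = v ^ m * (h : Gamma) * v ^ k) with hR
  have hmap : ∀ h h', R h h' → R ⟨_, goodConj_inv h.2⟩ ⟨_, goodConj_inv h'.2⟩ := by
    rintro h h' ⟨m, k, e⟩
    refine ⟨-k, -m, ?_⟩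
    simp only [e]; group
  let f : Quot R → Quot R := Quot.map (fun h => ⟨_, goodConj_inv h.2⟩) hmap
  have hf : ∀ x, f (f x) = x := by
    rintro ⟨h⟩
    exact congrArg (Quot.mk R) (Subtype.ext (inv_inv _))
  have hfix : ∀ x, f x ≠ x := by
    rintro ⟨h⟩ hx
    obtain ⟨m, k, e⟩ := (Equivalence.quot_mk_eq_iff (doubleCosetRel_equivalence v) _ _).1 hx.symm
    obtain ⟨h1, h2⟩ := (goodConj_iff v h).1 h.2
    exact inv_ne_double_coset h1 h2 m k (congrArg Subtype.val e)
  have := Fintype.ofFinite (Quot R)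
  have h1 := Equiv.Perm.card_fixedPoints_modEq (p := 2) (n := 1) (f := f)
    (by rw [pow_one]; exact (sq (M := Function.End (Quot R)) f).trans (funext hf))
  have h2 : IsEmpty (Function.fixedPoints f) := ⟨fun x => hfix x.1 x.2⟩
  rw [Nat.card_eq_fintype_card]
  rw [Fintype.card_eq_zero (α := Function.fixedPoints f)] at h1
  exact (Nat.modEq_zero_iff_dvd).1 h1

/-! ### Ping-pong -/

/-- A matrix sending the positive half-line onto the ping-pong interval of a letter. -/
def coneM : Gen → SL2Z
  | .a => ⟨!![1, 2; 0, 1], by norm_num [Matrix.det_fin_two_of]⟩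
  | .a' => ⟨!![-1, -1; 1, 0], by norm_num [Matrix.det_fin_two_of]⟩
  | .b => ⟨!![0, -1; 1, 1], by norm_num [Matrix.det_fin_two_of]⟩
  | .b' => ⟨!![1, 0; 2, 1], by norm_num [Matrix.det_fin_two_of]⟩
  | .c => ⟨!![1, 1; 1, 2], by norm_num [Matrix.det_fin_two_of]⟩
  | .c' => ⟨!![2, 1; 1, 1], by norm_num [Matrix.det_fin_two_of]⟩

/-- All entries are nonnegative, up to a global sign. -/
def NN (x : SL2Z) : Prop :=
  (0 ≤ x 0 0 ∧ 0 ≤ x 0 1 ∧ 0 ≤ x 1 0 ∧ 0 ≤ x 1 1) ∨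
    (x 0 0 ≤ 0 ∧ x 0 1 ≤ 0 ∧ x 1 0 ≤ 0 ∧ x 1 1 ≤ 0)

/-- All entries are positive, up to a global sign. -/
def PP (x : SL2Z) : Prop :=
  (0 < x 0 0 ∧ 0 < x 0 1 ∧ 0 < x 1 0 ∧ 0 < x 1 1) ∨
    (x 0 0 < 0 ∧ x 0 1 < 0 ∧ x 1 0 < 0 ∧ x 1 1 < 0)

/-- The transition matrix between the intervals of consecutive letters. -/
def transM (g k : Gen) : SL2Z := (coneM g)⁻¹ * genM g * coneM k

lemma NN.mul {x y : SL2Z} (hx : NN x) (hy : NN y) : NN (x * y) := by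
  rw [NN, mul_apply_two, mul_apply_two, mul_apply_two, mul_apply_two]
  rcases hx with ⟨a, b, c, d⟩ | ⟨a, b, c, d⟩ <;> rcases hy with ⟨a', b', c', d'⟩ | ⟨a', b', c', d'⟩
  · left; refine ⟨?_, ?_, ?_, ?_⟩ <;> positivity
  · right; refine ⟨?_, ?_, ?_, ?_⟩ <;> nlinarith
  · right; refine ⟨?_, ?_, ?_, ?_⟩ <;> nlinarith
  · left; refine ⟨?_, ?_, ?_, ?_⟩ <;> nlinarith

lemma NN.neg_or {x : SL2Z} (hx : NN x) : ∃ e : ℤ, (e = 1 ∨ e = -1) ∧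
    (0 ≤ e * x 0 0 ∧ 0 ≤ e * x 0 1 ∧ 0 ≤ e * x 1 0 ∧ 0 ≤ e * x 1 1) := by
  rcases hx with h | h
  · exact ⟨1, Or.inl rfl, by simpa using h⟩
  · exact ⟨-1, Or.inr rfl, by simpa using h⟩

lemma col_pos {p q r s a b : ℤ} (hp : 0 < p) (hq : 0 < q) (ha : 0 ≤ a) (hb : 0 ≤ b)
    (hdet : a * s - r * b = 1) : 0 < p * a + q * b := by
  rcases ha.eq_or_lt with rfl | ha
  · rcases hb.eq_or_lt with rfl | hb
    · simp at hdet
    · rw [mul_zero, zero_add]; positivity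
  · positivity

lemma PP.mul {x y : SL2Z} (hx : PP x) (hy : NN y) : PP (x * y) := by
  have hd := det_eq y
  have hd' : (-y 0 0) * (-y 1 1) - (-y 0 1) * (-y 1 0) = 1 := by linarith
  rw [PP, mul_apply_two, mul_apply_two, mul_apply_two, mul_apply_two]
  have key : ∀ p q a b c d : ℤ, 0 < p → 0 < q → 0 ≤ a → 0 ≤ b → 0 ≤ c → 0 ≤ d →
      a * d - b * c = 1 → 0 < p * a + q * c ∧ 0 < p * b + q * d := by
    intro p q a b c d hp hq ha hb hc hd h
    refine ⟨col_pos hp hq ha hc h, ?_⟩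
    have := col_pos (s := a) (r := c) hq hp hd hb (by linarith)
    linarith
  rcases hx with ⟨a, b, c, d⟩ | ⟨a, b, c, d⟩ <;> rcases hy with ⟨a', b', c', d'⟩ | ⟨a', b', c', d'⟩
  · left
    have h1 := key _ _ _ _ _ _ a b a' b' c' d' hd
    have h2 := key _ _ _ _ _ _ c d a' b' c' d' hd
    exact ⟨h1.1, h1.2, h2.1, h2.2⟩
  · right
    rw [← neg_nonneg] at a' b' c' d'
    have h1 := key _ _ _ _ _ _ a b a' b' c' d' hd'
    have h2 := key _ _ _ _ _ _ c d a' b' c' d' hd'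
    refine ⟨?_, ?_, ?_, ?_⟩ <;> linarith
  · right
    rw [← neg_pos] at a b c d
    have h1 := key _ _ _ _ _ _ a b a' b' c' d' hd
    have h2 := key _ _ _ _ _ _ c d a' b' c' d' hd
    refine ⟨?_, ?_, ?_, ?_⟩ <;> linarith
  · left
    rw [← neg_nonneg] at a' b' c' d'
    rw [← neg_pos] at a b c d
    have h1 := key _ _ _ _ _ _ a b a' b' c' d' hd'
    have h2 := key _ _ _ _ _ _ c d a' b' c' d' hd'
    refine ⟨?_, ?_, ?_, ?_⟩ <;> linarith

instance (p q : Gen) : Decidable (BadPair p q) :=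
  inferInstanceAs (Decidable ((p, q) ∈ (_ : List (Gen × Gen))))

/-- Entries of `coneM`. -/
def coneE : Gen → Fin 2 → Fin 2 → ℤ
  | .a => ![![1, 2], ![0, 1]]
  | .a' => ![![-1, -1], ![1, 0]]
  | .b => ![![0, -1], ![1, 1]]
  | .b' => ![![1, 0], ![2, 1]]
  | .c => ![![1, 1], ![1, 2]]
  | .c' => ![![2, 1], ![1, 1]]

/-- Entries of `genM`. -/
def genE : Gen → Fin 2 → Fin 2 → ℤ
  | .a => ![![1, 2], ![0, 1]]
  | .a' => ![![1, -2], ![0, 1]]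
  | .b => ![![1, 0], ![-2, 1]]
  | .b' => ![![1, 0], ![2, 1]]
  | .c => ![![1, -2], ![2, -3]]
  | .c' => ![![-3, 2], ![-2, 1]]

lemma coneM_apply (g : Gen) (i j : Fin 2) : coneM g i j = coneE g i j := by
  cases g <;> rfl

lemma genM_apply (g : Gen) (i j : Fin 2) : genM g i j = genE g i j := by
  have hA : ∀ i j, Amat i j = genE .a i j := fun _ _ => rfl
  have hB : ∀ i j, Bmat i j = genE .b i j := fun _ _ => rfl
  fin_cases i <;> fin_cases j <;> cases g <;>
    simp only [genM, Cmat, Fin.zero_eta, Fin.mk_one, mul_apply_two, inv00, inv01, inv10, inv11,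
      hA, hB] <;> decide

lemma transM_nn (g k : Gen) (h : ¬ BadPair g k) : NN (transM g k) := by
  revert h
  simp only [NN, transM, mul_apply_two, inv00, inv01, inv10, inv11, coneM_apply, genM_apply]
  cases g <;> cases k <;> decide

lemma transM_pp (g k l : Gen) (h : ¬ BadPair g k) (hgk : g ≠ k) (h' : ¬ BadPair k l)
    (hkl : k ≠ l) : PP (transM g k * transM k l) := by
  revert h hgk h' hkl
  simp only [PP, transM, mul_apply_two, inv00, inv01, inv10, inv11, coneM_apply, genM_apply]
  cases g <;> cases k <;> cases l <;> decide

lemma not_nn_mul {x y : SL2Z} (hx : (0 ≤ x 0 0 ∧ 0 ≤ x 0 1 ∧ x 1 0 ≤ 0 ∧ x 1 1 ≤ 0) ∨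
    (x 0 0 ≤ 0 ∧ x 0 1 ≤ 0 ∧ 0 ≤ x 1 0 ∧ 0 ≤ x 1 1)) (hy : NN y) : ¬ NN (x * y) := by
  have hd := det_eq (x * y)
  obtain ⟨e, he, h1, h2, h3, h4⟩ := hy.neg_or
  intro h
  obtain ⟨e', he', h1', h2', h3', h4'⟩ := h.neg_or
  simp only [mul_apply_two] at hd h1' h2' h3' h4'
  generalize x 0 0 = a at *
  generalize x 0 1 = b at *
  generalize x 1 0 = c at *
  generalize x 1 1 = d at *
  generalize y 0 0 = p at *
  generalize y 0 1 = q at *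
  generalize y 1 0 = r at *
  generalize y 1 1 = s at *
  have zero : ∀ a b p q r s : ℤ, 0 ≤ a → 0 ≤ b → 0 ≤ p → 0 ≤ q → 0 ≤ r → 0 ≤ s →
      a * p + b * r ≤ 0 → a * q + b * s ≤ 0 → a * p + b * r = 0 ∧ a * q + b * s = 0 := by
    intro a b p q r s ha hb hp hq hr hs h h'
    exact ⟨le_antisymm h (by positivity), le_antisymm h' (by positivity)⟩
  have fin1 : a * p + b * r = 0 → a * q + b * s = 0 → False := by
    intro h h'; rw [h, h'] at hd; simp at hd
  have fin2 : c * p + d * r = 0 → c * q + d * s = 0 → False := by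
    intro h h'; rw [h, h'] at hd; simp at hd
  rcases hx with ⟨k1, k2, k3, k4⟩ | ⟨k1, k2, k3, k4⟩ <;> rcases he with rfl | rfl <;>
    rcases he' with rfl | rfl
  · have := zero (-c) (-d) _ _ _ _ (by linarith) (by linarith) h1 h2 h3 h4 (by linarith)
      (by linarith)
    exact fin2 (by linarith) (by linarith)
  · have := zero a b _ _ _ _ (by linarith) (by linarith) h1 h2 h3 h4 (by linarith)
      (by linarith)
    exact fin1 (by linarith) (by linarith)
  · have := zero a b _ _ _ _ (by linarith) (by linarith) h1 h2 h3 h4 (by linarith)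
      (by linarith)
    exact fin1 (by linarith) (by linarith)
  · have := zero (-c) (-d) _ _ _ _ (by linarith) (by linarith) h1 h2 h3 h4 (by linarith)
      (by linarith)
    exact fin2 (by linarith) (by linarith)
  · have := zero (-a) (-b) _ _ _ _ (by linarith) (by linarith) h1 h2 h3 h4 (by linarith)
      (by linarith)
    exact fin1 (by linarith) (by linarith)
  · have := zero c d _ _ _ _ (by linarith) (by linarith) h1 h2 h3 h4 (by linarith)
      (by linarith)
    exact fin2 (by linarith) (by linarith)
  · have := zero c d _ _ _ _ (by linarith) (by linarith) h1 h2 h3 h4 (by linarith)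
      (by linarith)
    exact fin2 (by linarith) (by linarith)
  · have := zero (-a) (-b) _ _ _ _ (by linarith) (by linarith) h1 h2 h3 h4 (by linarith)
      (by linarith)
    exact fin1 (by linarith) (by linarith)

lemma cone_disjoint {g h : Gen} {x : SL2Z} (hg : NN ((coneM g)⁻¹ * x))
    (hh : NN ((coneM h)⁻¹ * x)) : g = h := by
  by_contra hne
  have h1 : (coneM h)⁻¹ * x = ((coneM h)⁻¹ * coneM g) * ((coneM g)⁻¹ * x) := by group
  rw [h1] at hh
  refine not_nn_mul ?_ hg hh
  revert hne
  simp only [mul_apply_two, inv00, inv01, inv10, inv11, coneM_apply]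
  cases g <;> cases h <;> decide

lemma phi6_cons (g : Gen) (l : List Gen) : phi6 (g :: l) = genM g * phi6 l := by
  simp [phi6]

lemma phi6_append (l l' : List Gen) : phi6 (l ++ l') = phi6 l * phi6 l' := by
  simp [phi6]

lemma phi6_nil : phi6 [] = 1 := rfl

lemma nn_of_chain (k : Gen) (l : List Gen) (g : Gen)
    (h : List.IsChain (fun p q => ¬ BadPair p q) (g :: l ++ [k])) :
    NN ((coneM g)⁻¹ * phi6 (g :: l) * coneM k) := by
  induction l generalizing g with
  | nil =>
    simp only [List.cons_append, List.nil_append, List.isChain_cons_cons] at h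
    rw [phi6_cons, phi6_nil, mul_one]
    exact transM_nn g k h.1
  | cons x l ih =>
    rw [List.cons_append, List.cons_append, List.isChain_cons_cons] at h
    have h1 := (transM_nn g x h.1).mul (ih x h.2)
    rw [phi6_cons]
    convert h1 using 1
    rw [transM]; group

lemma pp_of_chain (k : Gen) (l : List Gen) (g x : Gen)
    (h : List.IsChain (fun p q => ¬ BadPair p q ∧ p ≠ q) (g :: x :: l ++ [k])) :
    PP ((coneM g)⁻¹ * phi6 (g :: x :: l) * coneM k) := by
  cases l with
  | nil =>
    simp only [List.cons_append, List.nil_append, List.isChain_cons_cons] at h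
    have h1 := transM_pp g x k h.1.1 h.1.2 h.2.1.1 h.2.1.2
    convert h1 using 1
    rw [phi6_cons, phi6_cons, phi6_nil, transM, transM]; group
  | cons y l =>
    rw [List.cons_append, List.cons_append, List.cons_append, List.isChain_cons_cons,
      List.isChain_cons_cons] at h
    have h1 := (transM_pp g x y h.1.1 h.1.2 h.2.1.1 h.2.1.2).mul
      (nn_of_chain k l y (h.2.2.imp fun _ _ h => h.1))
    convert h1 using 1
    rw [phi6_cons, phi6_cons, transM, transM]; group

lemma exists_common_follower (g h : Gen) : ∃ k, ¬ BadPair g k ∧ ¬ BadPair h k := by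
  cases g <;> cases h <;> first
    | exact ⟨.a, by decide, by decide⟩
    | exact ⟨.b, by decide, by decide⟩
    | exact ⟨.c, by decide, by decide⟩

lemma exists_follower_ne (g h : Gen) : ∃ k, ¬ BadPair g k ∧ h ≠ k := by
  cases g <;> cases h <;> first
    | exact ⟨.a, by decide, by decide⟩
    | exact ⟨.b, by decide, by decide⟩
    | exact ⟨.c, by decide, by decide⟩

lemma isChain_append_singleton {R : Gen → Gen → Prop} {l : List Gen} {k : Gen}
    (hl : List.IsChain R l) (hk : ∀ x ∈ l.getLast?, R x k) : List.IsChain R (l ++ [k]) := by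
  rw [List.isChain_append]
  exact ⟨hl, List.isChain_singleton _, fun x hx y hy => by simp at hy; subst hy; exact hk x hx⟩

lemma head_eq_of_phi6_eq {g h : Gen} {l l' : List Gen}
    (hl : List.IsChain (fun p q => ¬ BadPair p q) (g :: l))
    (hl' : List.IsChain (fun p q => ¬ BadPair p q) (h :: l'))
    (heq : phi6 (g :: l) = phi6 (h :: l')) : g = h := by
  obtain ⟨k, hk, hk'⟩ := exists_common_follower ((g :: l).getLast (by simp))
    ((h :: l').getLast (by simp))
  have h1 := nn_of_chain k l g (isChain_append_singleton hl fun x hx => by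
    rw [List.getLast?_eq_getLast_of_ne_nil (by simp), Option.mem_some] at hx; rwa [← hx])
  have h2 := nn_of_chain k l' h (isChain_append_singleton hl' fun x hx => by
    rw [List.getLast?_eq_getLast_of_ne_nil (by simp), Option.mem_some] at hx; rwa [← hx])
  rw [mul_assoc] at h1 h2
  rw [← heq] at h2
  exact cone_disjoint h1 h2

lemma phi6_ne_one {g : Gen} {l : List Gen}
    (hl : List.IsChain (fun p q => ¬ BadPair p q) (g :: l)) : phi6 (g :: l) ≠ 1 := by
  intro heq
  obtain ⟨k, hk, hk'⟩ := exists_follower_ne ((g :: l).getLast (by simp)) g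
  have h1 := nn_of_chain k l g (isChain_append_singleton hl fun x hx => by
    rw [List.getLast?_eq_getLast_of_ne_nil (by simp), Option.mem_some] at hx; rwa [← hx])
  rw [heq, mul_one] at h1
  refine hk' (cone_disjoint h1 ?_)
  rw [inv_mul_cancel]
  left; simp

/-! ### Inverse words -/

/-- The formal inverse of a word. -/
def invList (l : List Gen) : List Gen := (l.map genInv).reverse

lemma genM_genInv (g : Gen) : genM (genInv g) = (genM g)⁻¹ := by
  cases g <;> simp [genM, genInv]

lemma phi6_invList (l : List Gen) : phi6 (invList l) = (phi6 l)⁻¹ := by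
  induction l with
  | nil => simp [invList, phi6]
  | cons g l ih =>
    rw [phi6_cons, mul_inv_rev, ← ih, ← genM_genInv, invList, invList, List.map_cons,
      List.reverse_cons, phi6_append, phi6_cons, phi6_nil, mul_one]

lemma badPair_genInv {g h : Gen} (hb : BadPair (genInv h) (genInv g)) : BadPair g h := by
  revert hb; cases g <;> cases h <;> decide

lemma genInv_injective {g h : Gen} (hgh : genInv g = genInv h) : g = h := by
  revert hgh; cases g <;> cases h <;> decide

lemma isChain_invList {l : List Gen} (hl : List.IsChain (fun p q => ¬ BadPair p q ∧ p ≠ q) l) :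
    List.IsChain (fun p q => ¬ BadPair p q ∧ p ≠ q) (invList l) := by
  rw [invList, List.isChain_reverse, List.isChain_map]
  exact hl.imp fun p q h => ⟨fun hb => h.1 (badPair_genInv hb), fun hb => h.2
    (genInv_injective hb.symm)⟩

/-! ### Attracting intervals -/

/-- Position of the ping-pong interval of a letter on the real line. -/
def rho : Gen → ℤ
  | .a' => 0
  | .b => 1
  | .b' => 2
  | .c => 3
  | .c' => 4
  | .a => 5

/-- The ping-pong interval of a letter. -/
def Dom : Gen → Set ℝ
  | .a' => {x | x < -1}
  | .b => {x | -1 < x ∧ x < 0}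
  | .b' => {x | 0 < x ∧ x < 1 / 2}
  | .c => {x | 1 / 2 < x ∧ x < 1}
  | .c' => {x | 1 < x ∧ x < 2}
  | .a => {x | 2 < x}

lemma lt_of_mem_dom {g h : Gen} {x y : ℝ} (hx : x ∈ Dom g) (hy : y ∈ Dom h)
    (hgh : rho g < rho h) : x < y := by
  revert hgh
  cases g <;> cases h <;> simp only [rho, Dom, Set.mem_ofPred_eq] at hx hy ⊢ <;> intro hgh <;>
    first
      | (exfalso; revert hgh; decide)
      | linarith

lemma cone_image (g : Gen) {s : ℝ} (hs : 0 < s) :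
    0 < entry (coneM g) 1 0 * s + entry (coneM g) 1 1 ∧
      (entry (coneM g) 0 0 * s + entry (coneM g) 0 1) /
        (entry (coneM g) 1 0 * s + entry (coneM g) 1 1) ∈ Dom g := by
  have h1 : (0 : ℝ) < s + 1 := by positivity
  have h2 : (0 : ℝ) < s + 2 := by positivity
  have h3 : (0 : ℝ) < 2 * s + 1 := by positivity
  simp only [entry_eq, coneM_apply]
  cases g <;> simp [coneE, Dom, div_lt_iff₀, lt_div_iff₀, h1, h2, h3, hs] <;>
    (try field_simp) <;> (try linarith)

lemma isRoot_inv {u : SL2Z} {r : ℝ} : IsRoot u⁻¹ r ↔ IsRoot u r := by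
  simp only [IsRoot, entry_eq, inv00, inv01, inv10, inv11]
  push_cast
  constructor <;> intro h <;> linear_combination -h

lemma isRoot_conj {m y : SL2Z} {s : ℝ} (hs : IsRoot y s)
    (hden : entry m 1 0 * s + entry m 1 1 ≠ 0) :
    IsRoot (m * y * m⁻¹) ((entry m 0 0 * s + entry m 0 1) / (entry m 1 0 * s + entry m 1 1)) := by
  have emul : ∀ (g h : SL2Z) (i j : Fin 2), entry (g * h) i j =
      entry g i 0 * entry h 0 j + entry g i 1 * entry h 1 j := by
    intro g h i j; simp only [entry_eq, mul_apply_two]; push_cast; ring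
  have e00 : entry m⁻¹ 0 0 = entry m 1 1 := by simp only [entry_eq, inv00]
  have e01 : entry m⁻¹ 0 1 = - entry m 0 1 := by simp only [entry_eq, inv01]; push_cast; ring
  have e10 : entry m⁻¹ 1 0 = - entry m 1 0 := by simp only [entry_eq, inv10]; push_cast; ring
  have e11 : entry m⁻¹ 1 1 = entry m 0 0 := by simp only [entry_eq, inv11]
  rw [IsRoot] at *
  simp only [emul, e00, e01, e10, e11]
  field_simp
  linear_combination (entry m 0 0 * entry m 1 1 - entry m 0 1 * entry m 1 0) ^ 2 * hs

lemma pp_disc_pos {y : SL2Z} (hy : PP y) : 0 < disc y := by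
  rw [disc_eq]
  rcases hy with ⟨a, b, c, d⟩ | ⟨a, b, c, d⟩
  · positivity
  · have := mul_pos_of_neg_of_neg b c
    positivity

lemma pp_exists_pos_root {y : SL2Z} (hy : PP y) : ∃ s : ℝ, 0 < s ∧ IsRoot y s := by
  obtain ⟨r, s, hrs, hr, hs⟩ := exists_isRoot (pp_disc_pos hy)
  obtain ⟨-, v2⟩ := isRoot_vieta hrs hr hs
  have h1 : (0 : ℝ) < entry y 0 1 * entry y 1 0 := by
    simp only [entry_eq]
    rcases hy with ⟨a, b, c, d⟩ | ⟨a, b, c, d⟩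
    · exact_mod_cast mul_pos b c
    · exact_mod_cast mul_pos_of_neg_of_neg b c
  have h2 : 0 < (entry y 1 0 ^ 2) * (-(r * s)) := by
    rw [v2] at h1; linarith
  have h3 : 0 < -(r * s) := pos_of_mul_pos_right h2 (sq_nonneg _)
  rcases lt_or_ge 0 r with h | h
  · exact ⟨r, h, hr⟩
  · refine ⟨s, ?_, hs⟩
    by_contra h'
    rw [not_lt] at h'
    nlinarith [mul_nonneg_of_nonpos_of_nonpos h h']

lemma exists_root_mem_dom {g x : Gen} {l : List Gen}
    (h : List.IsChain (fun p q => ¬ BadPair p q ∧ p ≠ q) (g :: x :: l ++ [g])) :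
    0 < disc (phi6 (g :: x :: l)) ∧ ∃ r ∈ Dom g, IsRoot (phi6 (g :: x :: l)) r := by
  have hpp := pp_of_chain g l g x h
  generalize phi6 (g :: x :: l) = u at *
  have hu : u = coneM g * ((coneM g)⁻¹ * u * coneM g) * (coneM g)⁻¹ := by group
  obtain ⟨s, hs, hr⟩ := pp_exists_pos_root hpp
  obtain ⟨h1, h2⟩ := cone_image g hs
  refine ⟨?_, _, h2, ?_⟩
  · rw [hu, disc_conj]; exact pp_disc_pos hpp
  · rw [hu]; exact isRoot_conj hr h1.ne'

/-! ### Periodic sequences of letters -/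

/-- The block of length `m` starting at position `s` of a sequence of letters. -/
def seg (g : ℕ → Gen) : ℕ → ℕ → List Gen
  | _, 0 => []
  | s, m + 1 => g s :: seg g (s + 1) m

/-- The product of the first `t` letters of a sequence. -/
def prefixProd (g : ℕ → Gen) (t : ℕ) : SL2Z := phi6 (seg g 0 t)

lemma seg_add (g : ℕ → Gen) (s m k : ℕ) : seg g s (m + k) = seg g s m ++ seg g (s + m) k := by
  induction m generalizing s with
  | zero => simp [seg]
  | succ m ih =>
    rw [show m + 1 + k = (m + k) + 1 by omega, seg, ih, seg, List.cons_append,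
      show s + 1 + m = s + (m + 1) by omega]

lemma seg_succ_right (g : ℕ → Gen) (s m : ℕ) : seg g s (m + 1) = seg g s m ++ [g (s + m)] := by
  rw [seg_add]; rfl

lemma prefixProd_mul (g : ℕ → Gen) (s m : ℕ) :
    prefixProd g s * phi6 (seg g s m) = prefixProd g (s + m) := by
  rw [prefixProd, prefixProd, seg_add, phi6_append, Nat.zero_add]

lemma seg_add_period {g : ℕ → Gen} {n : ℕ} (hg : ∀ t, g (t + n) = g t) (s m : ℕ) :
    seg g (s + n) m = seg g s m := by
  induction m generalizing s with
  | zero => rfl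
  | succ m ih => rw [seg, seg, hg, show s + n + 1 = s + 1 + n by omega, ih]

lemma prefixProd_add_period {g : ℕ → Gen} {n : ℕ} (hg : ∀ t, g (t + n) = g t) (t : ℕ) :
    prefixProd g (t + n) = prefixProd g n * prefixProd g t := by
  rw [add_comm, ← prefixProd_mul, ← Nat.zero_add n, seg_add_period hg]
  simp [prefixProd]

lemma prefixProd_add_mul {g : ℕ → Gen} {n : ℕ} (hg : ∀ t, g (t + n) = g t) (t m : ℕ) :
    prefixProd g (t + n * m) = prefixProd g n ^ m * prefixProd g t := by
  induction m with
  | zero => simp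
  | succ m ih =>
    rw [show t + n * (m + 1) = t + n * m + n by ring, prefixProd_add_period hg, ih, pow_succ',
      mul_assoc]

/-- Consecutive letters are distinct and do not form a forbidden subword. -/
def Reduced (g : ℕ → Gen) : Prop := ∀ t, ¬ BadPair (g t) (g (t + 1)) ∧ g t ≠ g (t + 1)

lemma isChain_seg {g : ℕ → Gen} (hg : Reduced g) (s m : ℕ) :
    List.IsChain (fun p q => ¬ BadPair p q ∧ p ≠ q) (seg g s m) := by
  induction m generalizing s with
  | zero => exact List.isChain_nil
  | succ m ih =>
    cases m with
    | zero => exact List.isChain_singleton _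
    | succ m => exact List.isChain_cons_cons.2 ⟨hg s, ih (s + 1)⟩

lemma seg_succ_succ (g : ℕ → Gen) (s m : ℕ) :
    seg g s (m + 2) = g s :: g (s + 1) :: seg g (s + 2) m := rfl

lemma invList_seg_succ (g : ℕ → Gen) (s m : ℕ) :
    invList (seg g s (m + 1)) = genInv (g (s + m)) :: invList (seg g s m) := by
  rw [seg_succ_right]; simp [invList]

/-- The conjugate of the period of a sequence read off from position `i + 1`. -/
def cyclicShift (g : ℕ → Gen) (n i : ℕ) : SL2Z := phi6 (seg g (i + 1) n)

lemma cyclicShift_conj {g : ℕ → Gen} {n : ℕ} (hp : ∀ t, g (t + n) = g t) (i : ℕ) :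
    prefixProd g (i + 1) * cyclicShift g n i * (prefixProd g (i + 1))⁻¹ = prefixProd g n := by
  rw [cyclicShift, prefixProd_mul, prefixProd_add_period hp]; group

lemma cyclicShift_roots {g : ℕ → Gen} (hg : Reduced g) {n : ℕ} (hn : 2 ≤ n)
    (hp : ∀ t, g (t + n) = g t) (i : ℕ) :
    0 < disc (cyclicShift g n i) ∧ (∃ r ∈ Dom (g (i + 1)), IsRoot (cyclicShift g n i) r) ∧
      ∃ r ∈ Dom (genInv (g i)), IsRoot (cyclicShift g n i) r := by
  obtain ⟨m, rfl⟩ := Nat.exists_eq_add_of_le' hn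
  have h1 := isChain_seg hg (i + 1) (m + 2 + 1)
  rw [seg_succ_right, hp, seg_succ_succ] at h1
  obtain ⟨hd, r, hr, hr'⟩ := exists_root_mem_dom h1
  have h2 := isChain_invList (isChain_seg hg i (m + 2 + 1))
  have e : invList (seg g i (m + 2 + 1)) = invList (seg g (i + 1) (m + 2)) ++ [genInv (g i)] := by
    rw [seg]; simp [invList]
  have e2 : invList (seg g (i + 1) (m + 2)) = genInv (g i) :: genInv (g (i + 1 + m)) ::
      invList (seg g (i + 1) m) := by
    rw [show m + 2 = (m + 1) + 1 from rfl, invList_seg_succ, invList_seg_succ,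
      show i + 1 + (m + 1) = i + (m + 2) by omega, hp]
  rw [e, e2] at h2
  obtain ⟨-, s, hs, hs'⟩ := exists_root_mem_dom h2
  rw [← e2, phi6_invList, isRoot_inv] at hs'
  exact ⟨hd, ⟨r, hr, hr'⟩, s, hs, hs'⟩

/-- The chords `{p, q}` and `{r, s}` of the hexagon of letters cross. -/
def ChordCross (p q r s : Gen) : Prop :=
  ((rho p - rho r) * (rho p - rho s)) * ((rho q - rho r) * (rho q - rho s)) < 0

instance (p q r s : Gen) : Decidable (ChordCross p q r s) :=
  inferInstanceAs (Decidable (_ < _))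

lemma ChordCross.ne {p q r s : Gen} (h : ChordCross p q r s) :
    p ≠ q ∧ r ≠ s ∧ p ≠ r ∧ p ≠ s ∧ q ≠ r ∧ q ≠ s := by
  unfold ChordCross at h
  refine ⟨?_, ?_, ?_, ?_, ?_, ?_⟩ <;> rintro rfl
  · exact absurd h (not_lt.2 (mul_self_nonneg _))
  · exact absurd h (not_lt.2 (mul_nonneg (mul_self_nonneg _) (mul_self_nonneg _)))
  all_goals simp at h

lemma rho_injective : Function.Injective rho := by
  intro p q h; cases p <;> cases q <;> first | rfl | (simp [rho] at h)

lemma sub_sign {g h : Gen} {x y : ℝ} (hx : x ∈ Dom g) (hy : y ∈ Dom h) (hne : g ≠ h) :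
    0 < ((rho g - rho h : ℤ) : ℝ) * (x - y) := by
  rcases lt_or_gt_of_ne (fun e => hne (rho_injective e)) with h1 | h1
  · have := lt_of_mem_dom hx hy h1
    have h2 : ((rho g - rho h : ℤ) : ℝ) < 0 := by exact_mod_cast sub_neg.2 h1
    exact mul_pos_of_neg_of_neg h2 (sub_neg.2 this)
  · have := lt_of_mem_dom hy hx h1
    have h2 : (0 : ℝ) < ((rho g - rho h : ℤ) : ℝ) := by exact_mod_cast sub_pos.2 h1
    exact mul_pos h2 (sub_pos.2 this)

lemma ChordCross.crosses {g : ℕ → Gen} (hg : Reduced g) {n : ℕ} (hn : 2 ≤ n)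
    (hp : ∀ t, g (t + n) = g t) {i j : ℕ}
    (h : ChordCross (genInv (g i)) (g (i + 1)) (genInv (g j)) (g (j + 1))) :
    Crosses (cyclicShift g n i) (cyclicShift g n j) := by
  obtain ⟨hd, ⟨r₂, hr₂, hr₂'⟩, r₁, hr₁, hr₁'⟩ := cyclicShift_roots hg hn hp i
  obtain ⟨hd', ⟨s₂, hs₂, hs₂'⟩, s₁, hs₁, hs₁'⟩ := cyclicShift_roots hg hn hp j
  obtain ⟨n1, n2, n3, n4, n5, n6⟩ := h.ne
  have q1 := sub_sign hr₁ hs₁ n3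
  have q2 := sub_sign hr₁ hs₂ n4
  have q3 := sub_sign hr₂ hs₁ n5
  have q4 := sub_sign hr₂ hs₂ n6
  have hr : r₁ ≠ r₂ := by
    rintro rfl; have := sub_sign hr₁ hr₂ n1; simp at this
  have hs : s₁ ≠ s₂ := by
    rintro rfl; have := sub_sign hs₁ hs₂ n2; simp at this
  rw [crosses_iff hd hd' hr hs hr₁' hr₂' hs₁' hs₂']
  have hq := mul_pos (mul_pos q1 q2) (mul_pos q3 q4)
  unfold ChordCross at h
  have h' : (((rho (genInv (g i)) - rho (genInv (g j)) : ℤ) : ℝ) *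
      ((rho (genInv (g i)) - rho (g (j + 1)) : ℤ) : ℝ)) *
      (((rho (g (i + 1)) - rho (genInv (g j)) : ℤ) : ℝ) *
      ((rho (g (i + 1)) - rho (g (j + 1)) : ℤ) : ℝ)) < 0 := by exact_mod_cast h
  refine neg_of_mul_pos_right (a := (((rho (genInv (g i)) - rho (genInv (g j)) : ℤ) : ℝ) *
      ((rho (genInv (g i)) - rho (g (j + 1)) : ℤ) : ℝ)) *
      (((rho (g (i + 1)) - rho (genInv (g j)) : ℤ) : ℝ) *
      ((rho (g (i + 1)) - rho (g (j + 1)) : ℤ) : ℝ))) ?_ h'.le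
  convert hq using 1
  ring

lemma prefixProd_ratio_injective {g : ℕ → Gen} (hg : Reduced g) {i j i' j' : ℕ}
    (h : ChordCross (genInv (g i)) (g (i + 1)) (genInv (g j)) (g (j + 1)))
    (h' : ChordCross (genInv (g i')) (g (i' + 1)) (genInv (g j')) (g (j' + 1)))
    (heq : prefixProd g (i + 1) * (prefixProd g (j + 1))⁻¹ =
      prefixProd g (i' + 1) * (prefixProd g (j' + 1))⁻¹) : i = i' ∧ j = j' := by
  have hch : ∀ s m, List.IsChain (fun p q => ¬ BadPair p q) (seg g s m) :=
    fun s m => (isChain_seg hg s m).imp fun _ _ h => h.1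
  have hch' : ∀ s m, List.IsChain (fun p q => ¬ BadPair p q) (invList (seg g s m)) :=
    fun s m => (isChain_invList (isChain_seg hg s m)).imp fun _ _ h => h.1
  have hpos : ∀ s m, phi6 (seg g s (m + 1)) ≠ 1 := fun s m => phi6_ne_one (hch s (m + 1))
  have key : ∀ i j i' j' : ℕ,
      ChordCross (genInv (g i)) (g (i + 1)) (genInv (g j)) (g (j + 1)) →
      prefixProd g (i + 1) * (prefixProd g (j + 1))⁻¹ =
        prefixProd g (i' + 1) * (prefixProd g (j' + 1))⁻¹ → ¬ i < i' := by
    intro i j i' j' h heq hlt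
    obtain ⟨m, rfl⟩ := Nat.exists_eq_add_of_lt hlt
    rw [show i + m + 1 + 1 = i + 1 + (m + 1) by omega, ← prefixProd_mul g (i + 1) (m + 1), mul_assoc] at heq
    have heq := mul_left_cancel heq
    rcases lt_trichotomy j j' with hj | rfl | hj
    · obtain ⟨l, rfl⟩ := Nat.exists_eq_add_of_lt hj
      rw [show j + l + 1 + 1 = j + 1 + (l + 1) by omega,
      ← prefixProd_mul g (j + 1) (l + 1), mul_inv_rev,
        ← mul_assoc] at heq
      have heq := mul_right_cancel ((one_mul _).trans heq)
      have heq := (eq_mul_inv_iff_mul_eq.1 heq)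
      rw [one_mul] at heq
      exact h.ne.2.2.2.2.2 (head_eq_of_phi6_eq (hch (i + 1) (m + 1)) (hch (j + 1) (l + 1)) heq.symm)
    · have heq := mul_right_cancel ((one_mul _).trans heq)
      exact hpos _ _ heq.symm
    · obtain ⟨l, rfl⟩ := Nat.exists_eq_add_of_lt hj
      rw [show j' + l + 1 + 1 = j' + 1 + (l + 1) by omega,
      ← prefixProd_mul g (j' + 1) (l + 1), mul_inv_rev] at heq
      have heq := mul_right_cancel heq
      rw [← phi6_invList, invList_seg_succ] at heq
      have hc := hch' (j' + 1) (l + 1)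
      rw [invList_seg_succ] at hc
      have := head_eq_of_phi6_eq hc (hch (i + 1) (m + 1)) heq
      rw [show j' + 1 + l = j' + l + 1 by omega] at this
      exact h.ne.2.2.2.2.1 this.symm
  have hi : i = i' := le_antisymm (not_lt.1 (key i' j' i j h' heq.symm))
    (not_lt.1 (key i j i' j' h heq))
  subst hi
  refine ⟨rfl, ?_⟩
  have hP := inv_injective (mul_left_cancel heq)
  rcases lt_trichotomy j j' with hj | hj | hj
  · obtain ⟨l, rfl⟩ := Nat.exists_eq_add_of_lt hj
    rw [show j + l + 1 + 1 = j + 1 + (l + 1) by omega,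
      ← prefixProd_mul g (j + 1) (l + 1)] at hP
    exact absurd (mul_left_cancel ((mul_one _).trans hP)).symm (hpos _ _)
  · exact hj
  · obtain ⟨l, rfl⟩ := Nat.exists_eq_add_of_lt hj
    rw [show j' + l + 1 + 1 = j' + 1 + (l + 1) by omega,
      ← prefixProd_mul g (j' + 1) (l + 1)] at hP
    exact absurd (mul_left_cancel (hP.trans (mul_one _).symm)) (hpos _ _)

lemma prefixProd_ratio_injective_mod {g : ℕ → Gen} (hg : Reduced g) {n : ℕ}
    (hp : ∀ t, g (t + n) = g t) {i j i' j' : ℕ} (hi : i < n) (hj : j < n) (hi' : i' < n)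
    (hj' : j' < n)
    (h : ChordCross (genInv (g i)) (g (i + 1)) (genInv (g j)) (g (j + 1)))
    (h' : ChordCross (genInv (g i')) (g (i' + 1)) (genInv (g j')) (g (j' + 1))) {m l : ℤ}
    (heq : prefixProd g (i' + 1) * (prefixProd g (j' + 1))⁻¹ =
      prefixProd g n ^ m * (prefixProd g (i + 1) * (prefixProd g (j + 1))⁻¹) *
        prefixProd g n ^ l) : i = i' ∧ j = j' := by
  obtain ⟨a, b, rfl⟩ : ∃ a b : ℕ, m = a - b := ⟨m.toNat, (-m).toNat, by omega⟩
  obtain ⟨c, d, rfl⟩ : ∃ c d : ℕ, l = c - d := ⟨l.toNat, (-l).toNat, by omega⟩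
  have hp' : ∀ t k, g (t + n * k) = g t := by
    intro t k
    induction k with
    | zero => rfl
    | succ k ih => rw [show t + n * (k + 1) = t + n * k + n by ring, hp, ih]
  have hs : ∀ t k, prefixProd g (t + n * k + 1) = prefixProd g n ^ k * prefixProd g (t + 1) := by
    intro t k
    rw [show t + n * k + 1 = t + 1 + n * k by ring, prefixProd_add_mul hp]
  have hs' : ∀ t k, g (t + n * k + 1) = g (t + 1) := by
    intro t k
    rw [show t + n * k + 1 = t + 1 + n * k by ring, hp']
  have := prefixProd_ratio_injective hg (i := i + n * a) (j := j + n * d) (i' := i' + n * b)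
    (j' := j' + n * c) (by rw [hp', hp', hs', hs']; exact h) (by rw [hp', hp', hs', hs']; exact h')
    (by
      rw [hs, hs, hs, hs, mul_inv_rev, mul_inv_rev, mul_assoc (prefixProd g n ^ b),
        ← mul_assoc (prefixProd g (i' + 1)), heq]
      group)
  obtain ⟨h1, h2⟩ := this
  have h1 := congrArg (· % n) h1
  have h2 := congrArg (· % n) h2
  simp only [Nat.add_mul_mod_self_left, Nat.mod_eq_of_lt, hi, hj, hi', hj'] at h1 h2
  exact ⟨h1, h2⟩

/-! ### Counting crossing chords of the hexagon -/

/-- Cyclic position of a letter on the hexagon. -/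
def hexPos : Gen → ℕ
  | .c' => 0
  | .a => 1
  | .a' => 2
  | .b => 3
  | .b' => 4
  | .c => 5

/-- The chord `{p, q}` of the hexagon: `v < 6` stands for the short diagonal `{v - 1, v + 1}`,
`6 + v` for the long diagonal `{v, v + 3}`. -/
def chordKind (p q : Gen) : Fin 9 :=
  if (hexPos p + 2) % 6 = hexPos q then Fin.ofNat 9 ((hexPos p + 1) % 6)
  else if (hexPos q + 2) % 6 = hexPos p then Fin.ofNat 9 ((hexPos q + 1) % 6)
  else Fin.ofNat 9 (6 + hexPos p % 3)

/-- Indicator of two diagonals crossing. -/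
def crossNum (k l : Fin 9) : ℤ :=
  if k.val < 6 ∧ l.val < 6 then
    if (k.val + 1) % 6 = l.val ∨ (l.val + 1) % 6 = k.val then 1 else 0
  else if 6 ≤ k.val ∧ 6 ≤ l.val then
    if k = l then 0 else 1
  else if k.val % 3 = l.val % 3 then 1 else 0

/-- Indicator of a vertex being an endpoint of a diagonal. -/
def incidence (p : Gen) (k : Fin 9) : ℤ :=
  if k.val < 6 then
    if (k.val + 1) % 6 = hexPos p ∨ (hexPos p + 1) % 6 = k.val then 1 else 0
  else if k.val % 3 = hexPos p % 3 then 1 else 0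

lemma incidence_chordKind (p x y : Gen) (h : ¬ BadPair x y) (h' : x ≠ y) :
    incidence p (chordKind (genInv x) y) =
      (if genInv x = p then 1 else 0) + (if y = p then 1 else 0) := by
  revert h h'
  cases x <;> cases y <;> first | (intro h; exact absurd (by decide) h) |
    (intro _ h; exact absurd rfl h) | (intro _ _; cases p <;> decide)

lemma crossNum_chordKind (x y x' y' : Gen) (h : ¬ BadPair x y) (h' : x ≠ y)
    (hh : ¬ BadPair x' y') (hh' : x' ≠ y') :
    crossNum (chordKind (genInv x) y) (chordKind (genInv x') y') =
      if ChordCross (genInv x) y (genInv x') y' then 1 else 0 := by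
  revert h h' hh hh'
  cases x <;> cases y <;> first | (intro h; exact absurd (by decide) h) |
    (intro _ h; exact absurd rfl h) | (intro _ _; cases x' <;> cases y' <;>
      first | (intro h; exact absurd (by decide) h) |
      (intro _ h; exact absurd rfl h) | (intro _ _; decide))

lemma sum_comp_fin (n : ℕ) (k : ℕ → Fin 9) (F : Fin 9 → ℤ) :
    ∑ i ∈ Finset.range n, F (k i) =
      ∑ κ, (((Finset.range n).filter fun i => k i = κ).card : ℤ) * F κ := by
  rw [← Finset.sum_fiberwise (Finset.range n) k]
  refine Finset.sum_congr rfl fun κ _ => ?_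
  rw [Finset.sum_congr rfl (g := fun _ => F κ) fun i hi => by rw [(Finset.mem_filter.1 hi).2]]
  simp

lemma sum_genInv_eq {g : ℕ → Gen} {n : ℕ} (hp : ∀ t, g (t + n) = g t) (p : Gen) :
    ∑ i ∈ Finset.range n, (if genInv (g i) = p then (1 : ℤ) else 0) =
      ∑ i ∈ Finset.range n, (if g (i + 1) = genInv p then (1 : ℤ) else 0) := by
  have e : ∀ q, (genInv q = p) = (q = genInv p) := by
    intro q; cases q <;> cases p <;> simp [genInv]
  simp only [e]
  have h1 := Finset.sum_range_succ (fun i => if g i = genInv p then (1 : ℤ) else 0) n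
  rw [Finset.sum_range_succ', ← Nat.zero_add n, hp, Nat.zero_add] at h1
  exact (add_right_cancel h1).symm

lemma sum_incidence_genInv {g : ℕ → Gen} (hg : Reduced g) {n : ℕ} (hp : ∀ t, g (t + n) = g t)
    (p : Gen) :
    ∑ i ∈ Finset.range n, incidence p (chordKind (genInv (g i)) (g (i + 1))) =
      ∑ i ∈ Finset.range n, incidence (genInv p) (chordKind (genInv (g i)) (g (i + 1))) := by
  have e : genInv (genInv p) = p := by cases p <;> rfl
  rw [Finset.sum_congr rfl fun i _ => incidence_chordKind p (g i) (g (i + 1)) (hg i).1 (hg i).2,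
    Finset.sum_congr rfl fun i _ =>
      incidence_chordKind (genInv p) (g i) (g (i + 1)) (hg i).1 (hg i).2,
    Finset.sum_add_distrib, Finset.sum_add_distrib, sum_genInv_eq hp, sum_genInv_eq hp, e, add_comm]

lemma sq_le_three_mul_sum_crossNum {d : Fin 9 → ℤ}
    (hd : ∀ p, ∑ k, d k * incidence p k = ∑ k, d k * incidence (genInv p) k) :
    (∑ k, d k) ^ 2 ≤ 3 * ∑ k, d k * ∑ l, d l * crossNum k l := by
  have h1 := hd .a
  have h2 := hd .b
  have h3 := hd .c
  simp only [Fin.sum_univ_succ, Fin.sum_univ_zero, incidence, crossNum, hexPos, genInv] at h1 h2 h3 ⊢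
  simp at h1 h2 h3 ⊢
  have e3 : d 3 = d 2 + d 6 - d 8 := by linarith
  have e1 : d 1 = d 0 + d 7 - d 6 := by linarith
  have e5 : d 5 = d 4 + d 8 - d 7 := by linarith
  rw [e1, e3, e5]
  nlinarith [sq_nonneg ((d 0 + d 2 + d 7) - (d 2 + d 4 + d 6)),
    sq_nonneg ((d 0 + d 2 + d 7) - (d 0 + d 4 + d 8)),
    sq_nonneg ((d 2 + d 4 + d 6) - (d 0 + d 4 + d 8)),
    sq_nonneg (d 6), sq_nonneg (d 7), sq_nonneg (d 8)]

/-- The pairs of positions of a sequence with crossing chords. -/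
def crossingPairs (g : ℕ → Gen) (n : ℕ) : Finset (ℕ × ℕ) :=
  (Finset.range n ×ˢ Finset.range n).filter fun x =>
    ChordCross (genInv (g x.1)) (g (x.1 + 1)) (genInv (g x.2)) (g (x.2 + 1))

lemma sq_le_three_mul_card_crossingPairs {g : ℕ → Gen} (hg : Reduced g) {n : ℕ}
    (hp : ∀ t, g (t + n) = g t) : n ^ 2 ≤ 3 * (crossingPairs g n).card := by
  let k : ℕ → Fin 9 := fun i => chordKind (genInv (g i)) (g (i + 1))
  have hcard : ((crossingPairs g n).card : ℤ) =
      ∑ i ∈ Finset.range n, ∑ j ∈ Finset.range n, crossNum (k i) (k j) := by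
    rw [crossingPairs, Finset.card_filter, Finset.sum_product]
    push_cast
    refine Finset.sum_congr rfl fun i _ => Finset.sum_congr rfl fun j _ => ?_
    rw [crossNum_chordKind _ _ _ _ (hg i).1 (hg i).2 (hg j).1 (hg j).2]
  have hn : (n : ℤ) = ∑ κ, (((Finset.range n).filter fun i => k i = κ).card : ℤ) := by
    simpa using sum_comp_fin n k fun _ => 1
  have key := sq_le_three_mul_sum_crossNum
    (d := fun κ => (((Finset.range n).filter fun i => k i = κ).card : ℤ)) fun p => by
      rw [← sum_comp_fin n k, ← sum_comp_fin n k]; exact sum_incidence_genInv hg hp p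
  have e : ∀ κ, ∑ l, (((Finset.range n).filter fun i => k i = l).card : ℤ) * crossNum κ l =
      ∑ j ∈ Finset.range n, crossNum κ (k j) := fun κ => (sum_comp_fin n k (crossNum κ)).symm
  simp only [e] at key
  rw [← hn, ← sum_comp_fin n k fun κ => ∑ j ∈ Finset.range n, crossNum κ (k j), ← hcard] at key
  exact_mod_cast key

/-! ### The lower bound -/

lemma prefixProd_mem (g : ℕ → Gen) (t : ℕ) : prefixProd g t ∈ Gamma := phi6_mem _

lemma goodConj_of_chordCross {g : ℕ → Gen} (hg : Reduced g) {n : ℕ} (hn : 2 ≤ n)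
    (hp : ∀ t, g (t + n) = g t) {v : Gamma} {k : ℕ} (hk : k ≠ 0) (hv : 0 < disc (v : SL2Z))
    (hvk : (v : SL2Z) ^ k = prefixProd g n) {i j : ℕ}
    (h : ChordCross (genInv (g i)) (g (i + 1)) (genInv (g j)) (g (j + 1))) :
    GoodConj v (⟨prefixProd g (i + 1), prefixProd_mem g _⟩ *
      ⟨prefixProd g (j + 1), prefixProd_mem g _⟩⁻¹) := by
  rw [goodConj_iff]
  refine ⟨hv, ?_⟩
  have h1 := (crosses_conj (prefixProd g (i + 1)) _ _).2 (h.crosses hg hn hp)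
  rw [cyclicShift_conj hp] at h1
  have e : prefixProd g (i + 1) * cyclicShift g n j * (prefixProd g (i + 1))⁻¹ =
      (prefixProd g (i + 1) * (prefixProd g (j + 1))⁻¹) * prefixProd g n *
        (prefixProd g (i + 1) * (prefixProd g (j + 1))⁻¹)⁻¹ := by
    rw [← cyclicShift_conj hp j]; group
  rw [e, ← hvk, crosses_pow_iff _ _ _ (cheb_ne_zero hv hk)] at h1
  exact h1

lemma card_crossingPairs_le {g : ℕ → Gen} (hg : Reduced g) {n : ℕ} (hn : 2 ≤ n)
    (hp : ∀ t, g (t + n) = g t) {v : Gamma} {k : ℕ} (hk : k ≠ 0) (hv : 0 < disc (v : SL2Z))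
    (hvk : (v : SL2Z) ^ k = prefixProd g n) :
    (crossingPairs g n).card ≤ sTwo v * (k * k) := by
  have : NeZero k := ⟨hk⟩
  have := finite_goodConj_quot v
  have hmem : ∀ x : crossingPairs g n, (x.1.1 < n ∧ x.1.2 < n) ∧
      ChordCross (genInv (g x.1.1)) (g (x.1.1 + 1)) (genInv (g x.1.2)) (g (x.1.2 + 1)) := by
    intro x
    simpa [crossingPairs] using x.2
  let H : crossingPairs g n → {h : Gamma // GoodConj v h} := fun x =>
    ⟨_, goodConj_of_chordCross hg hn hp hk hv hvk (hmem x).2⟩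
  have hrep : ∀ y : {h : Gamma // GoodConj v h}, ∃ m l : ℤ,
      (y : Gamma) = v ^ m * ((Quot.mk (fun h h' : {h : Gamma // GoodConj v h} =>
        ∃ m k : ℤ, (h' : Gamma) = v ^ m * (h : Gamma) * v ^ k) y).out : Gamma) * v ^ l := by
    intro y
    exact (doubleCosetRel_equivalence v).quot_mk_eq_iff _ _ |>.1 (Quot.out_eq _)
  choose M L hML using hrep
  let f : crossingPairs g n → Quot (fun h h' : {h : Gamma // GoodConj v h} =>
      ∃ m k : ℤ, (h' : Gamma) = v ^ m * (h : Gamma) * v ^ k) × ZMod k × ZMod k :=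
    fun x => (Quot.mk _ (H x), (M (H x) : ZMod k), (L (H x) : ZMod k))
  have hf : Function.Injective f := by
    intro x y hxy
    obtain ⟨h1, h2⟩ := Prod.mk.inj hxy
    obtain ⟨h2, h3⟩ := Prod.mk.inj h2
    obtain ⟨a, ha⟩ := (ZMod.intCast_eq_intCast_iff_dvd_sub _ _ _).1 h2
    obtain ⟨b, hb⟩ := (ZMod.intCast_eq_intCast_iff_dvd_sub _ _ _).1 h3
    have hx := hML (H x)
    have hy := hML (H y)
    rw [← h1] at hy
    have hxy : ((H y : Gamma) : SL2Z) =
        prefixProd g n ^ a * ((H x : Gamma) : SL2Z) * prefixProd g n ^ b := by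
      have e1 : M (H y) = k * a + M (H x) := by linarith
      have e2 : L (H y) = L (H x) + k * b := by linarith
      rw [← hvk, ← zpow_natCast, ← zpow_mul, ← zpow_mul]
      have : (H y : Gamma) = v ^ (k * a) * (H x : Gamma) * v ^ (k * b) := by
        rw [hy, hx, e1, e2, zpow_add, zpow_add]
        simp only [mul_assoc]
      rw [this]
      push_cast
      rfl
    obtain ⟨⟨x1, x2⟩, hc⟩ := hmem x
    obtain ⟨⟨y1, y2⟩, hc'⟩ := hmem y
    obtain ⟨r1, r2⟩ := prefixProd_ratio_injective_mod hg hp x1 x2 y1 y2 hc hc' hxy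
    exact Subtype.ext (Prod.ext r1 r2)
  have hcard := Nat.card_le_card_of_injective f hf
  rwa [Nat.card_prod, Nat.card_prod, Nat.card_zmod, Nat.card_eq_fintype_card,
    Fintype.card_coe] at hcard

lemma seg_eq_map (g : ℕ → Gen) (s m : ℕ) : seg g s m = (List.range' s m).map g := by
  induction m generalizing s with
  | zero => rfl
  | succ m ih => rw [seg, ih]; rfl

lemma cget6_add_length (w : List Gen) (t : ℕ) : cget6 w (t + w.length) = cget6 w t := by
  simp [cget6]

lemma prefixProd_cget6 (w : List Gen) : prefixProd (cget6 w) w.length = phi6 w := by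
  rw [prefixProd, seg_eq_map]
  congr 1
  refine List.ext_getElem (by simp) fun i h1 h2 => ?_
  simp [cget6, Nat.mod_eq_of_lt h2, h2]

lemma cget6_mod (w : List Gen) (t : ℕ) : cget6 w (t % w.length) = cget6 w t := by
  simp [cget6]

lemma cget6_mod_succ (w : List Gen) (t : ℕ) : cget6 w (t % w.length + 1) = cget6 w (t + 1) := by
  simp [cget6]

theorem almost_simple_geodesics_stmt11 (w : List Gen) (hn : 2 ≤ w.length)
    (hcr : CyclRed6 w)
    (hne : ∀ i : ℕ, i < w.length → cget6 w i ≠ cget6 w (i + 1)) :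
    ((w.length : ℚ) ^ 2) / 6 ≤ (I6 w : ℚ) := by
  have hpos : 0 < w.length := by omega
  have hg : Reduced (cget6 w) := by
    intro t
    rw [← cget6_mod w t, ← cget6_mod_succ w t]
    exact ⟨hcr.2 _ (Nat.mod_lt _ hpos), hne _ (Nat.mod_lt _ hpos)⟩
  have hp := cget6_add_length w
  have hdisc : 0 < disc (phi6 w) := by
    rw [← prefixProd_cget6, ← cyclicShift_conj hp 0, disc_conj]
    exact (cyclicShift_roots hg hn hp 0).1
  have hex := exists_root_decomposition (g := ⟨phi6 w, phi6_mem w⟩) hdisc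
  rw [I6, Iγ, dif_pos hex]
  obtain ⟨hk, -, hvk⟩ := hex.choose_spec
  generalize hex.choose.1 = v at *
  generalize hex.choose.2 = k at *
  have hvk' : (v : SL2Z) ^ k = phi6 w := (congrArg Subtype.val hvk).symm
  have hv : 0 < disc (v : SL2Z) := disc_pos_of_pow (by rw [hvk']; exact hdisc)
  have h1 := sq_le_three_mul_card_crossingPairs hg hp
  have h2 := card_crossingPairs_le hg hn hp (by omega) hv (hvk'.trans (prefixProd_cget6 w).symm)
  obtain ⟨s, hs⟩ := even_sTwo v
  rw [hs] at h2 ⊢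
  rw [Nat.mul_div_cancel_left s (by norm_num)]
  have h3 : ((w.length ^ 2 : ℕ) : ℚ) ≤ ((3 * (2 * s * (k * k)) : ℕ) : ℚ) := by
    exact_mod_cast h1.trans (Nat.mul_le_mul_left 3 h2)
  have h4 : (1 : ℚ) ≤ k := by exact_mod_cast hk
  push_cast at h3 ⊢
  linarith
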